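/- Let F_1, F_2 ∈ K[x_1,…,x_n] be coprime polynomials of the same degree d > 0, and assume that for each i ∈ {1,2} one of the coefficients in the expansion of F_i equals 1. For an integer m ≥ 2d, set M = M_m = 2·binom(m+n−d, n) − binom(m+n−2d, n) and M' = M'_m = binom(m+n, n) − M. For each positive integer r, let V_{F_1,F_2}(r) ⊂ K be the k-vector space spanned by all products Π_α α^{n_α}, where α runs over the nonzero coefficients of F_1 and F_2, the n_α are nonnegative integers and Σ_α n_α = r; put d_r = dim_k V_{F_1,F_2}(r). Then: (1) M'_m = binom(m+n,n) − 2·binom(m+n−d,n) + binom(m+n−2d,n), which is O(m^{n−2}) as m → ∞; (2) if for some g = (g_1,…,g_n) ∈ (O_S^*)^n the elements g^i = g_1^{i_1}⋯g_n^{i_n}, for i ∈ ℤ_{≥0}^n with i_1+⋯+i_n ≤ m, are linearly nondegenerate over V_{F_1,F_2}(Mr+1) for some positive integer r and some m ≥ 2d, then M·N_{S,gcd}(F_1(g), F_2(g)) ≤ (M' + (d_{Mr}/d_{M(r−1)})·M − M)·m·n·max_{1≤i≤n} h(g_i) + c·M·(h(F_1)+h(F_2)) + c'·M·max{0, 2𝔤−2+|S|},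 where c = (d_{Mr}/d_{M(r−1)})·(1 + M(r+1)) and c' = d_{Mr}^2·M/(2·d_{M(r−1)}). -/

import Mathlib

open scoped BigOperators Classical

namespace FunctionFieldGCD

variable {K : Type*} [Field K] {Point : Type*}

/-- Truncated order of vanishing `v_𝔭^0(f) = max {0, v_𝔭(f)}`. -/
noncomputable def v0 (v : Point → K → ℤ) (p : Point) (f : K) : ℤ := max 0 (v p f)

/-- The height `h(f) = Σ_𝔭 −min{0, v_𝔭(f)}` of `f`, counting poles with multiplicity. -/
noncomputable def height (v : Point → K → ℤ) (f : K) : ℤ := ∑ᶠ p : Point, max 0 (-(v p f))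

/-- `min {v_𝔭^0(f), v_𝔭^0(g)}` with the convention `v_𝔭^0(0) = +∞`. -/
noncomputable def minv0 (v : Point → K → ℤ) (p : Point) (f g : K) : ℤ :=
  if f = 0 then v0 v p g else if g = 0 then v0 v p f else min (v0 v p f) (v0 v p g)

/-- `N_{S,gcd}(f,g) = Σ_{𝔭∉S} min{v_𝔭^0(f), v_𝔭^0(g)}`. -/
noncomputable def NSgcd (v : Point → K → ℤ) (S : Set Point) (f g : K) : ℤ :=
  ∑ᶠ p ∈ Sᶜ, minv0 v p f g

/-- `h_gcd(f,g) = Σ_{𝔭} min{v_𝔭^0(f), v_𝔭^0(g)}`. -/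
noncomputable def hgcd (v : Point → K → ℤ) (f g : K) : ℤ :=
  ∑ᶠ p : Point, minv0 v p f g

/-- `N_S(f)`: number of zeros of `f` outside `S`, with multiplicity. -/
noncomputable def NS (v : Point → K → ℤ) (S : Set Point) (f : K) : ℤ :=
  ∑ᶠ p ∈ Sᶜ, v0 v p f

/-- `N̄_S(f)`: number of zeros of `f` outside `S`, without multiplicity. -/
noncomputable def NSbar (v : Point → K → ℤ) (S : Set Point) (f : K) : ℤ :=
  ∑ᶠ p ∈ Sᶜ, min 1 (v0 v p f)

/-- membership in the group `O_S^*` of `S`-units. -/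
def IsSUnit (v : Point → K → ℤ) (S : Set Point) (f : K) : Prop :=
  f ≠ 0 ∧ ∀ p ∉ S, v p f = 0

/-- `f` is a constant, i.e. belongs to (the image of) `k`. -/
def IsConst (k : Type*) [Field k] [Algebra k K] (f : K) : Prop :=
  ∃ c : k, algebraMap k K c = f

/-- Projective height of a finite tuple: `h(f_0,…,f_m) = Σ_𝔭 −min_j v_𝔭(f_j)`. -/
noncomputable def heightProj {ι : Type*} [Fintype ι] (v : Point → K → ℤ) (f : ι → K) : ℤ :=
  ∑ᶠ p : Point,
    -(if h : (Finset.univ : Finset ι).Nonempty then Finset.univ.inf' h fun j => v p (f j) else 0)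

/-- `v_𝔭(F) = min_{i ∈ I_F} v_𝔭(a_i)` for a multivariable polynomial `F = Σ a_i x^i`. -/
noncomputable def vPoly {n : ℕ} (v : Point → K → ℤ) (p : Point) (F : MvPolynomial (Fin n) K) :
    ℤ :=
  if h : F.support.Nonempty then F.support.inf' h fun mm => v p (MvPolynomial.coeff mm F) else 0

/-- The height `h(F) = Σ_𝔭 −v_𝔭(F)` of a multivariable polynomial. -/
noncomputable def hPoly {n : ℕ} (v : Point → K → ℤ) (F : MvPolynomial (Fin n) K) : ℤ :=
  ∑ᶠ p : Point, -(vPoly v p F)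

/-- The relevant height `h̃(F) = Σ_𝔭 −min{0, v_𝔭(F)}` of a multivariable polynomial. -/
noncomputable def htilde {n : ℕ} (v : Point → K → ℤ) (F : MvPolynomial (Fin n) K) : ℤ :=
  ∑ᶠ p : Point, max 0 (-(vPoly v p F))

/-- `max_{1≤i≤n} h(g_i)` (heights are nonnegative, so the `toNat` is harmless). -/
noncomputable def maxHeight {n : ℕ} (v : Point → K → ℤ) (g : Fin n → K) : ℤ :=
  ((Finset.univ.sup fun i => (height v (g i)).toNat : ℕ) : ℤ)

/-- `u^m = u_1^{m_1} ⋯ u_n^{m_n}` for an integer exponent vector `m`. -/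
noncomputable def prodZPow {n : ℕ} (u : Fin n → K) (mm : Fin n → ℤ) : K :=
  ∏ j, u j ^ mm j

/-- Coprimality of multivariable polynomials: no common non-unit factor. -/
def CoprimePoly {n : ℕ} (F G : MvPolynomial (Fin n) K) : Prop :=
  ∀ P : MvPolynomial (Fin n) K, P ∣ F → P ∣ G → IsUnit P

/-- `P` is a monomial `a·x^i`. -/
def IsMonomialPoly {n : ℕ} (P : MvPolynomial (Fin n) K) : Prop :=
  ∃ (mm : Fin n →₀ ℕ) (a : K), P = MvPolynomial.monomial mm a

/-- Axioms expressing that `K`, equipped with the family of normalized order functions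
`v_𝔭` indexed by the points `𝔭 ∈ C(k)` of a smooth projective curve `C` of genus `genus`
over the algebraically closed field `k`, is the function field `k(C)`. -/
structure IsFunctionField (k : Type*) [Field k] [Algebra k K]
    (v : Point → K → ℤ) (genus : ℕ) : Prop where
  v_mul : ∀ (p : Point) (f g : K), f ≠ 0 → g ≠ 0 → v p (f * g) = v p f + v p g
  v_add : ∀ (p : Point) (f g : K), f ≠ 0 → g ≠ 0 → f + g ≠ 0 → min (v p f) (v p g) ≤ v p (f + g)
  v_one : ∀ p : Point, v p (1 : K) = 0
  v_algebraMap : ∀ (p : Point) (c : k), c ≠ 0 → v p (algebraMap k K c) = 0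
  exists_uniformizer : ∀ p : Point, ∃ f : K, f ≠ 0 ∧ v p f = 1
  finite_support : ∀ f : K, f ≠ 0 → {p : Point | v p f ≠ 0}.Finite
  sum_v : ∀ f : K, f ≠ 0 → ∑ᶠ p : Point, v p f = 0
  const_of_nonneg : ∀ f : K, f ≠ 0 → (∀ p : Point, 0 ≤ v p f) → ∃ c : k, algebraMap k K c = f
  riemann_roch : ∀ D : Point →₀ ℤ, 2 * (genus : ℤ) - 2 < D.sum (fun _ d => d) →
    (Module.finrank k
        (Submodule.span k {f : K | f = 0 ∨ ∀ p : Point, -(D p) ≤ v p f}) : ℤ)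
      = D.sum (fun _ d => d) + 1 - genus

/-- Axioms for the global derivation `η ↦ η' = dη/dt` on `K` determined by an element
`t` as in Proposition 12 (`dt p` plays the role of `v_𝔭(d_𝔭 t)`). -/
structure IsGoodDerivation (k : Type*) [Field k] [Algebra k K]
    (v : Point → K → ℤ) (genus : ℕ) (D : K → K) (dt : Point → ℤ) : Prop where
  map_add : ∀ f g : K, D (f + g) = D f + D g
  leibniz : ∀ f g : K, D (f * g) = f * D g + g * D f
  map_const : ∀ c : k, D (algebraMap k K c) = 0
  ker_const : ∀ f : K, D f = 0 → ∃ c : k, algebraMap k K c = f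
  v_D_of_vne : ∀ f : K, f ≠ 0 → ∀ p : Point, v p f ≠ 0 →
    D f ≠ 0 ∧ v p (D f) = v p f - 1 - dt p
  v_D_of_veq : ∀ f : K, f ≠ 0 → ∀ p : Point, v p f = 0 → D f ≠ 0 → -(dt p) ≤ v p (D f)
  sum_dt : ∑ᶠ p : Point, max 0 (dt p) ≤ 3 * (genus : ℤ)

/-- `D_u(F) = Σ_{i∈I_F} ((a_i u^i)' / u^i)·x^i`. -/
noncomputable def Du {n : ℕ} (D : K → K) (u : Fin n → K) (F : MvPolynomial (Fin n) K) :
    MvPolynomial (Fin n) K :=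
  ∑ mm ∈ F.support,
    MvPolynomial.monomial mm
      ((D (MvPolynomial.coeff mm F * ∏ j, u j ^ mm j)) / ∏ j, u j ^ mm j)


/-- `M = M_m = 2·C(m+n−d, n) − C(m+n−2d, n)`. -/
def Mconst (n d m : ℕ) : ℕ := 2 * Nat.choose (m + n - d) n - Nat.choose (m + n - 2 * d) n

/-- `M' = M'_m = C(m+n, n) − M_m`. -/
def Mprime (n d m : ℕ) : ℕ := Nat.choose (m + n) n - Mconst n d m

/-- The `k`-span of the set of nonzero coefficients of `F₁` and `F₂`; its `r`-th power is
the space `V_{F₁,F₂}(r)` spanned by all products of `r` coefficients. -/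
noncomputable def coeffSpan2 {K : Type*} [Field K] (k : Type*) [Field k] [Algebra k K]
    {n : ℕ} (F1 F2 : MvPolynomial (Fin n) K) : Submodule k K :=
  Submodule.span k
    ((fun mm => MvPolynomial.coeff mm F1) '' ↑F1.support ∪
      (fun mm => MvPolynomial.coeff mm F2) '' ↑F2.support)

end FunctionFieldGCD

set_option linter.all false

namespace FunctionFieldGCD
section Part1
section Deriv
open Polynomial TensorProduct
lemma exists_derivation (k K : Type*) [Field k] [Field K] [Algebra k K] [CharZero k]
   [Algebra k[X] K] [IsScalarTower k k[X] K] [FaithfulSMul k[X] K] [Algebra.IsAlgebraic k[X] K] :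
   ∃ D : Derivation k K K, D (algebraMap k[X] K X) = 1 := by
  letI := FractionRing.liftAlgebra k[X] K
  haveI : IsScalarTower k[X] (FractionRing k[X]) K := inferInstance
  haveI : Algebra.IsAlgebraic (FractionRing k[X]) K := by
    exact Algebra.IsAlgebraic.extendScalars (R := k[X]) (FaithfulSMul.algebraMap_injective _ _)
  haveI : CharZero (FractionRing k[X]) := charZero_of_injective_algebraMap (FaithfulSMul.algebraMap_injective k[X] _)
  haveI : Algebra.FormallyEtale (FractionRing k[X]) K := Algebra.FormallyEtale.of_isSeparable _ _
  haveI : Algebra.FormallyEtale k[X] (FractionRing k[X]) := Algebra.FormallyEtale.of_isLocalization (nonZeroDivisors k[X])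
  haveI : Algebra.FormallyEtale k[X] K := Algebra.FormallyEtale.comp k[X] (FractionRing k[X]) K
  let e := KaehlerDifferential.tensorKaehlerEquivOfFormallyEtale k k[X] K
  let φ : K ⊗[k[X]] Ω[k[X]⁄k] →ₗ[K] K :=
    TensorProduct.AlgebraTensorModule.lift
      { toFun := fun x => x • ((Algebra.linearMap k[X] K).comp (KaehlerDifferential.polynomialEquiv k).toLinearMap)
        map_add' := fun x y => add_smul _ _ _
        map_smul' := fun a x => by simp [mul_smul] }
  refine ⟨(φ.comp e.symm.toLinearMap).compDer (KaehlerDifferential.D k K), ?_⟩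
  have : e (1 ⊗ₜ KaehlerDifferential.D k k[X] X) = KaehlerDifferential.D k K (algebraMap k[X] K X) := by
    simp [e]
  show φ (e.symm (KaehlerDifferential.D k K (algebraMap k[X] K X))) = 1
  rw [← this]
  simp [φ]
end Deriv
end Part1
end FunctionFieldGCD

namespace FunctionFieldGCD
section Part2
section Wr
variable {k K : Type*} [Field k] [Field K] [Algebra k K]

lemma wr_aux (D : Derivation k K K) (hker : ∀ f, D f = 0 → ∃ c : k, algebraMap k K c = f) :
    ∀ (N : ℕ) (f : Fin N → K), LinearIndependent k f → ∀ c : Fin N → K,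
      (∀ i < N, ∑ j, c j * (D^[i]) (f j) = 0) → ∀ j, c j = 0 := by
  intro N
  induction N with
  | zero => intro f _ c _ j; exact j.elim0
  | succ N ih =>
    intro f hf c hc
    have hf' : LinearIndependent k (fun j : Fin N => f j.castSucc) :=
      hf.comp _ (Fin.castSucc_injective N)
    by_cases hl : c (Fin.last N) = 0
    · have h1 : ∀ j : Fin N, c j.castSucc = 0 := by
        apply ih _ hf' (fun j => c j.castSucc)
        intro i hi
        have := hc i (by omega)
        rw [Fin.sum_univ_castSucc, hl] at this
        simpa using this
      intro j
      refine Fin.lastCases hl h1 j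
    · exfalso
      set c' : Fin (N+1) → K := fun j => c j / c (Fin.last N) with hc'
      have hc'l : c' (Fin.last N) = 1 := by simp [hc', hl]
      have h0 : ∀ i < N + 1, ∑ j, c' j * (D^[i]) (f j) = 0 := by
        intro i hi
        have := hc i hi
        have h2 : ∑ j, c' j * (D^[i]) (f j) = (∑ j, c j * (D^[i]) (f j)) / c (Fin.last N) := by
          rw [Finset.sum_div]
          apply Finset.sum_congr rfl
          intro j _
          simp only [hc']; ring
        rw [h2, this, zero_div]
      have h1 : ∀ j : Fin N, D (c' j.castSucc) = 0 := by
        apply ih _ hf' (fun j => D (c' j.castSucc))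
        intro i hi
        have e1 := congrArg D (h0 i (by omega))
        have e2 := h0 (i+1) (by omega)
        rw [map_sum, map_zero] at e1
        simp only [Derivation.leibniz, smul_eq_mul] at e1
        simp only [Function.iterate_succ_apply'] at e2
        rw [Finset.sum_add_distrib, e2, zero_add, Fin.sum_univ_castSucc, hc'l] at e1
        simp only [Derivation.map_one_eq_zero, mul_zero, add_zero] at e1
        rw [← e1]
        exact Finset.sum_congr rfl fun j _ => mul_comm _ _
      have h2 : ∀ j, ∃ a : k, algebraMap k K a = c' j := by
        intro j
        refine Fin.lastCases ⟨1, by rw [hc'l, map_one]⟩ (fun j => hker _ (h1 j)) j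
      choose a ha using h2
      have h3 : ∑ j, a j • f j = 0 := by
        have := h0 0 (by omega)
        simpa [Algebra.smul_def, ha] using this
      have h4 := Fintype.linearIndependent_iff.1 hf a h3 (Fin.last N)
      have := ha (Fin.last N)
      rw [h4, hc'l, map_zero] at this
      exact zero_ne_one this

/-- Wronskian matrix -/
noncomputable def wrM (D : Derivation k K K) {N : ℕ} (f : Fin N → K) : Matrix (Fin N) (Fin N) K :=
  Matrix.of fun i j => (D^[(i : ℕ)]) (f j)

lemma wr_ne_zero (D : Derivation k K K) (hker : ∀ f, D f = 0 → ∃ c : k, algebraMap k K c = f)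
    {N : ℕ} (f : Fin N → K) (hf : LinearIndependent k f) : (wrM D f).det ≠ 0 := by
  intro h
  obtain ⟨c, hc0, hc⟩ := Matrix.exists_mulVec_eq_zero_iff.2 h
  apply hc0
  funext j
  refine wr_aux D hker N f hf c ?_ j
  intro i hi
  have := congrFun hc ⟨i, hi⟩
  simp only [Matrix.mulVec, dotProduct, wrM, Matrix.of_apply, Pi.zero_apply] at this
  rw [← this]
  exact Finset.sum_congr rfl fun j _ => mul_comm _ _

lemma iter_sum_smul (D : Derivation k K K) {ι : Type*} (s : Finset ι) (b : ι → k) (f : ι → K) (i : ℕ) :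
    (D^[i]) (∑ j ∈ s, b j • f j) = ∑ j ∈ s, b j • (D^[i]) (f j) := by
  induction i with
  | zero => simp
  | succ i ih => simp [Function.iterate_succ_apply', ih]

/-- Wronskians of two bases of the same space differ by a nonzero constant. -/
lemma wr_change (D : Derivation k K K) {N : ℕ} (f f' : Fin N → K)
    (hf' : LinearIndependent k f') (hspan : ∀ j, f' j ∈ Submodule.span k (Set.range f)) :
    ∃ c : k, c ≠ 0 ∧ (wrM D f').det = (wrM D f).det * algebraMap k K c := by
  have h1 : ∀ j, ∃ a : Fin N → k, ∑ i, a i • f i = f' j := fun j =>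
    (Submodule.mem_span_range_iff_exists_fun k).1 (hspan j)
  choose a ha using h1
  let B : Matrix (Fin N) (Fin N) k := Matrix.of fun i j => a j i
  have hW : wrM D f' = wrM D f * B.map (algebraMap k K) := by
    ext i j
    simp only [wrM, Matrix.of_apply, Matrix.mul_apply, Matrix.map_apply, B]
    rw [← ha j, iter_sum_smul]
    exact Finset.sum_congr rfl fun l _ => by rw [Algebra.smul_def, mul_comm]
  refine ⟨B.det, ?_, ?_⟩
  · intro h
    obtain ⟨x, hx0, hx⟩ := Matrix.exists_mulVec_eq_zero_iff.2 h
    apply hx0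
    have : ∑ j, x j • f' j = 0 := by
      simp only [← ha, Finset.smul_sum]
      rw [Finset.sum_comm]
      apply Finset.sum_eq_zero
      intro i _
      have := congrFun hx i
      simp only [Matrix.mulVec, dotProduct, B, Matrix.of_apply, Pi.zero_apply] at this
      simp only [smul_smul]
      rw [← Finset.sum_smul]
      rw [show ∑ j, x j * a j i = 0 by rw [← this]; exact Finset.sum_congr rfl fun j _ => mul_comm _ _]
      simp
    funext j
    exact Fintype.linearIndependent_iff.1 hf' x this j
  · rw [hW, Matrix.det_mul, ← RingHom.mapMatrix_apply, ← RingHom.map_det]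
end Wr

section Disc
open Polynomial
variable {k O : Type*} [Field k] [CharZero k] [CommRing O] [IsDomain O] [Algebra k[X] O] [FaithfulSMul k[X] O]
  {n : ℕ} (b : Module.Basis (Fin n) k[X] O)

noncomputable def trM : Matrix (Fin n) (Fin n) k[X] :=
  Matrix.of fun i j => Algebra.trace k[X] O (b i * b j)

lemma trM_det_ne_zero : (trM b).det ≠ 0 := by
  intro h
  obtain ⟨c, hc0, hc⟩ := Matrix.exists_mulVec_eq_zero_iff.2 h
  set u : O := ∑ j, c j • b j with hu
  have hu0 : u ≠ 0 := by
    intro h0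
    apply hc0
    funext j
    exact Fintype.linearIndependent_iff.1 b.linearIndependent c h0 j
  have htr : ∀ x : O, Algebra.trace k[X] O (x * u) = 0 := by
    intro x
    have h1 : ∀ i, Algebra.trace k[X] O (b i * u) = 0 := by
      intro i
      have := congrFun hc i
      simp only [Matrix.mulVec, dotProduct, trM, Matrix.of_apply, Pi.zero_apply] at this
      rw [hu, Finset.mul_sum, map_sum, ← this]
      apply Finset.sum_congr rfl
      intro j _
      rw [mul_smul_comm, map_smul, smul_eq_mul, mul_comm]
    rw [← b.sum_repr x, Finset.sum_mul, map_sum]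
    apply Finset.sum_eq_zero
    intro i _
    rw [smul_mul_assoc, map_smul, h1, smul_zero]
  haveI : Module.Finite k[X] O := Module.Finite.of_basis b
  have hint : IsAlgebraic k[X] u := (Algebra.IsIntegral.isIntegral u).isAlgebraic
  obtain ⟨r, hr, x, hx⟩ := hint.exists_nonzero_dvd (mem_nonZeroDivisors_of_ne_zero hu0)
  have := htr x
  rw [mul_comm, ← hx, Algebra.trace_algebraMap_of_basis b, Fintype.card_fin] at this
  have hn : n ≠ 0 := by
    rintro rfl
    have : Subsingleton O := b.repr.toEquiv.subsingleton
    exact not_subsingleton O this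
  rw [nsmul_eq_mul] at this
  rcases mul_eq_zero.1 this with h | h
  · exact hn (by exact_mod_cast h)
  · exact hr h

lemma trM_order (c : k) {r : ℕ} (a : Fin r → Fin n → k) (ha : LinearIndependent k a)
    (h : ∀ l x, (X - C c) ∣ Algebra.trace k[X] O ((∑ i, C (a l i) • b i) * x)) :
    (X - C c) ^ r ∣ (trM b).det := by
  let β := Module.Basis.sumExtend ha
  haveI : Finite (Fin r ⊕ (Module.Basis.sumExtendIndex ha)) := Module.Finite.finite_basis β
  haveI : Finite (Module.Basis.sumExtendIndex ha) :=
    Finite.of_injective (Sum.inr : _ → Fin r ⊕ (Module.Basis.sumExtendIndex ha)) Sum.inr_injective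
  haveI : Fintype (Module.Basis.sumExtendIndex ha) := Fintype.ofFinite _
  have hcard : Fintype.card (Fin r ⊕ (Module.Basis.sumExtendIndex ha)) = n := by
    rw [← Module.finrank_eq_card_basis β]; simp
  let σ : Fin n ≃ (Fin r ⊕ (Module.Basis.sumExtendIndex ha)) :=
    (Fintype.equivFinOfCardEq hcard).symm
  have hσ : ∀ l, β (Sum.inl l) = a l := fun l => by
    simp [β, Module.Basis.sumExtend]
    rfl
  let B : Matrix (Fin n) (Fin n) k := Matrix.of fun s i => β (σ s) i
  have hB : IsUnit B.det := by
    have : LinearIndependent k B.row := by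
      have := (β.reindex σ.symm).linearIndependent
      have e : B.row = ⇑(β.reindex σ.symm) := by
        ext s i
        simp [B, Matrix.row]
      rw [e]
      exact this
    exact (Matrix.isUnit_iff_isUnit_det _).1 (Matrix.linearIndependent_rows_iff_isUnit.1 this)
  let q : Fin n → k[X] := fun s => if (σ s).isLeft then X - C c else 1
  have hdiv : ∀ s j, q s ∣ ((B.map C) * trM b) s j := by
    intro s j
    by_cases hs : (σ s).isLeft
    · obtain ⟨l, hl⟩ := Sum.isLeft_iff.1 hs
      have : ((B.map C) * trM b) s j = Algebra.trace k[X] O ((∑ i, C (a l i) • b i) * b j) := by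
        rw [Matrix.mul_apply, Finset.sum_mul, map_sum]
        apply Finset.sum_congr rfl
        intro i _
        rw [smul_mul_assoc, map_smul, smul_eq_mul]
        simp [B, trM, hl, hσ]
      rw [this]
      simp only [q, hs, if_true]
      exact h l _
    · simp only [q, hs]
      exact one_dvd _
  choose A hA using hdiv
  have hdet : ((B.map C) * trM b).det = (∏ s, q s) * (Matrix.of A).det := by
    rw [← Matrix.det_mul_column]
    congr 1
    ext1 s j
    exact hA s j
  have hq : ∏ s, q s = (X - C c) ^ r := by
    have : ∏ s, q s = ∏ s : (Fin r ⊕ (Module.Basis.sumExtendIndex ha)), (if s.isLeft then X - C c else 1) :=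
      Equiv.prod_comp σ (fun s => if s.isLeft then X - C c else (1 : k[X]))
    rw [this]
    rw [Fintype.prod_sum_type]
    simp
  rw [Matrix.det_mul, hq] at hdet
  have hu : IsUnit (B.map C).det := by
    have : (B.map C).det = C B.det := by
      rw [← RingHom.mapMatrix_apply, ← RingHom.map_det]
    rw [this]
    exact hB.map C
  have : (X - C c) ^ r ∣ (B.map C).det * (trM b).det := ⟨_, hdet⟩
  exact (hu.dvd_mul_left).1 this

lemma trM_natDegree (e : ℕ) (he : 0 < e) (w : Fin n → ℕ)
    (h : ∀ i j, e * (Algebra.trace k[X] O (b i * b j)).natDegree ≤ w i + w j) :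
    e * (trM b).det.natDegree ≤ 2 * ∑ i, w i := by
  rw [mul_comm, ← Nat.le_div_iff_mul_le he]
  rw [Matrix.det_apply]
  apply Polynomial.natDegree_sum_le_of_forall_le
  intro σ _
  have h1 : (Equiv.Perm.sign σ • ∏ i, trM b (σ i) i).natDegree ≤ (∏ i, trM b (σ i) i).natDegree := by
    rcases Int.units_eq_one_or (Equiv.Perm.sign σ) with h | h <;> simp [h]
  refine h1.trans ((Polynomial.natDegree_prod_le _ _).trans ?_)
  rw [Nat.le_div_iff_mul_le he, mul_comm, Finset.mul_sum]
  calc ∑ i, e * (trM b (σ i) i).natDegree ≤ ∑ i, (w (σ i) + w i) := Finset.sum_le_sum fun i _ => h _ _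
    _ = 2 * ∑ i, w i := by
      rw [Finset.sum_add_distrib, Equiv.sum_comp σ w]; ring

lemma trM_total (e : ℕ) (he : 0 < e) (w : Fin n → ℕ)
    (h : ∀ i j, e * (Algebra.trace k[X] O (b i * b j)).natDegree ≤ w i + w j)
    (ρ : k → ℕ) (hρ : ∀ c, (X - C c) ^ (ρ c) ∣ (trM b).det) :
    (∀ c, ρ c ≠ 0 → c ∈ (trM b).det.roots.toFinset) ∧
      ∀ s : Finset k, e * ∑ c ∈ s, ρ c ≤ 2 * ∑ i, w i := by
  have h0 := trM_det_ne_zero b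
  have h1 : ∀ c, ρ c ≤ (trM b).det.rootMultiplicity c := fun c =>
    (Polynomial.le_rootMultiplicity_iff h0).2 (hρ c)
  refine ⟨fun c hc => ?_, fun s => ?_⟩
  · rw [Multiset.mem_toFinset, ← Multiset.count_pos, Polynomial.count_roots]
    have := h1 c; omega
  · refine le_trans (Nat.mul_le_mul_left e ?_) (trM_natDegree b e he w h)
    calc ∑ c ∈ s, ρ c ≤ ∑ c ∈ s, (trM b).det.roots.count c :=
          Finset.sum_le_sum fun c _ => by rw [Polynomial.count_roots]; exact h1 c
      _ ≤ Multiset.card (trM b).det.roots := by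
          rw [← Multiset.toFinset_sum_count_eq]
          refine (Finset.sum_le_sum_of_ne_zero ?_)
          intro c _ hc
          rw [Multiset.mem_toFinset]
          exact Multiset.count_ne_zero.1 hc
      _ ≤ _ := Polynomial.card_roots' _
end Disc
end Part2
end FunctionFieldGCD

namespace FunctionFieldGCD
section Part3
section Val
variable {k K Point : Type*} [Field k] [Field K] [Algebra k K]
  {v : Point → K → ℤ} {genus : ℕ} (hK : IsFunctionField k v genus)
include hK

lemma v_neg (p : Point) (f : K) (hf : f ≠ 0) : v p (-f) = v p f := by
  have h1 : v p (-1 : K) = 0 := by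
    have := hK.v_algebraMap p (-1 : k) (by simp)
    simpa using this
  have := hK.v_mul p (-1) f (by simp) hf
  rw [h1] at this
  simpa using this

/-- the `k`-module of elements of order at least `a` at `p`. -/
def Lv (p : Point) (a : ℤ) : Submodule k K where
  carrier := {f | f = 0 ∨ a ≤ v p f}
  zero_mem' := Or.inl rfl
  add_mem' := by
    intro f g hf hg
    by_cases h0 : f + g = 0
    · exact Or.inl h0
    by_cases hf0 : f = 0
    · subst hf0; simpa using hg
    by_cases hg0 : g = 0
    · subst hg0; simpa using hf
    right
    have := hK.v_add p f g hf0 hg0 h0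
    rcases hf with hf | hf
    · exact absurd hf hf0
    rcases hg with hg | hg
    · exact absurd hg hg0
    exact (le_min hf hg).trans this
  smul_mem' := by
    intro c f hf
    by_cases hc : c = 0
    · subst hc; left; simp
    by_cases hf0 : f = 0
    · subst hf0; left; simp
    right
    rcases hf with hf | hf
    · exact absurd hf hf0
    rw [Algebra.smul_def, hK.v_mul p _ _ (by simpa using hc) hf0, hK.v_algebraMap p c hc]
    simpa using hf

lemma mem_Lv {p : Point} {a : ℤ} {f : K} : f ∈ Lv hK p a ↔ f = 0 ∨ a ≤ v p f := Iff.rfl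

lemma mem_Lv' {p : Point} {a : ℤ} {f : K} (hf : f ≠ 0) : f ∈ Lv hK p a ↔ a ≤ v p f := by
  rw [mem_Lv]; simp [hf]

lemma Lv_mono {p : Point} {a b : ℤ} (h : b ≤ a) : Lv hK p a ≤ Lv hK p b := by
  rintro f (hf | hf)
  · exact Or.inl hf
  · exact Or.inr (h.trans hf)

lemma Lv_self {p : Point} (f : K) : f ∈ Lv hK p (v p f) := Or.inr le_rfl

lemma Lv_mul {p : Point} {a b : ℤ} {f g : K} (hf : f ∈ Lv hK p a) (hg : g ∈ Lv hK p b) :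
    f * g ∈ Lv hK p (a + b) := by
  by_cases hf0 : f = 0
  · subst hf0; left; simp
  by_cases hg0 : g = 0
  · subst hg0; left; simp
  rw [mem_Lv' hK hf0] at hf
  rw [mem_Lv' hK hg0] at hg
  right
  rw [hK.v_mul p f g hf0 hg0]
  omega

lemma Lv_one {p : Point} : (1 : K) ∈ Lv hK p 0 := Or.inr (by rw [hK.v_one])

lemma Lv_const {p : Point} (c : k) : algebraMap k K c ∈ Lv hK p 0 := by
  rw [Algebra.algebraMap_eq_smul_one]
  exact Submodule.smul_mem _ _ (Lv_one hK)

lemma Lv_prod {p : Point} {ι : Type*} (s : Finset ι) (f : ι → K) (a : ι → ℤ)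
    (h : ∀ i ∈ s, f i ∈ Lv hK p (a i)) : ∏ i ∈ s, f i ∈ Lv hK p (∑ i ∈ s, a i) := by
  induction s using Finset.induction_on with
  | empty => simpa using Lv_one hK
  | insert i s hi ih =>
    rw [Finset.prod_insert hi, Finset.sum_insert hi]
    exact Lv_mul hK (h i (by simp)) (ih fun j hj => h j (by simp [hj]))

lemma Lv_pow {p : Point} {f : K} {a : ℤ} (h : f ∈ Lv hK p a) (m : ℕ) : f ^ m ∈ Lv hK p (m * a) := by
  have := Lv_prod hK (Finset.range m) (fun _ => f) (fun _ => a) (fun _ _ => h)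
  simpa using this

lemma v_inv (p : Point) (f : K) (hf : f ≠ 0) : v p f⁻¹ = - v p f := by
  have := hK.v_mul p f f⁻¹ hf (inv_ne_zero hf)
  rw [mul_inv_cancel₀ hf, hK.v_one] at this
  omega

lemma v_div (p : Point) (f g : K) (hf : f ≠ 0) (hg : g ≠ 0) : v p (f / g) = v p f - v p g := by
  rw [div_eq_mul_inv, hK.v_mul p _ _ hf (inv_ne_zero hg), v_inv hK p g hg]; ring

lemma v_pow (p : Point) (f : K) (hf : f ≠ 0) (m : ℕ) : v p (f ^ m) = m * v p f := by
  induction m with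
  | zero => simp [hK.v_one]
  | succ m ih => rw [pow_succ, hK.v_mul p _ _ (pow_ne_zero _ hf) hf, ih]; push_cast; ring

lemma v_prod (p : Point) {ι : Type*} (s : Finset ι) (f : ι → K) (hf : ∀ i ∈ s, f i ≠ 0) :
    v p (∏ i ∈ s, f i) = ∑ i ∈ s, v p (f i) := by
  induction s using Finset.induction_on with
  | empty => simpa using hK.v_one p
  | insert i s hi ih =>
    rw [Finset.prod_insert hi, Finset.sum_insert hi, hK.v_mul, ih fun j hj => hf j (by simp [hj])]
    · exact hf i (by simp)
    · exact Finset.prod_ne_zero_iff.2 fun j hj => hf j (by simp [hj])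

lemma Lv_div {p : Point} {a : ℤ} {f g : K} (hf : f ∈ Lv hK p a) (hg : g ≠ 0) :
    f / g ∈ Lv hK p (a - v p g) := by
  rw [div_eq_mul_inv, sub_eq_add_neg, ← v_inv hK p g hg]
  exact Lv_mul hK hf (Lv_self hK _)

lemma sum_of_subset (f : K) (hf : f ≠ 0) (T : Finset Point) (hT : ∀ p, v p f ≠ 0 → p ∈ T) :
    ∑ p ∈ T, v p f = 0 := by
  rw [← hK.sum_v f hf, finsum_eq_sum_of_support_subset]
  intro p hp
  exact hT p hp

/-- ultrametric sum with distinct orders -/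
lemma sum_distinct (p : Point) {ι : Type*} (s : Finset ι) (f : ι → K) (hf : ∀ i ∈ s, f i ≠ 0)
    (hinj : ∀ i ∈ s, ∀ j ∈ s, v p (f i) = v p (f j) → i = j) (i : ι) (hi : i ∈ s) :
    ∑ j ∈ s, f j ≠ 0 ∧ v p (∑ j ∈ s, f j) ≤ v p (f i) := by
  obtain ⟨i0, hi0, hmin⟩ := s.exists_min_image (fun j => v p (f j)) ⟨i, hi⟩
  have hrest : ∑ j ∈ s.erase i0, f j ∈ Lv hK p (v p (f i0) + 1) := by
    apply Submodule.sum_mem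
    intro j hj
    right
    have h1 := hmin j (Finset.mem_of_mem_erase hj)
    have h2 : v p (f i0) ≠ v p (f j) := fun h =>
      Finset.ne_of_mem_erase hj (hinj i0 hi0 j (Finset.mem_of_mem_erase hj) h).symm
    omega
  have hnot : ∑ j ∈ s, f j ∉ Lv hK p (v p (f i0) + 1) := by
    intro h
    rw [← Finset.add_sum_erase s f hi0] at h
    have := (Submodule.add_mem_iff_left _ hrest).1 h
    rw [mem_Lv' hK (hf i0 hi0)] at this
    omega
  rw [mem_Lv, not_or] at hnot
  refine ⟨hnot.1, ?_⟩
  have := hmin i hi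
  omega

/-- Riemann-Roch space -/
def LD (D : Point →₀ ℤ) : Submodule k K := ⨅ p, Lv hK p (-(D p))

lemma mem_LD {D : Point →₀ ℤ} {f : K} : f ∈ LD hK D ↔ ∀ p, f ∈ Lv hK p (-(D p)) := by
  simp [LD]

def deg' (D : Point →₀ ℤ) : ℤ := D.sum fun _ d => d

omit hK in
lemma deg_add (D E : Point →₀ ℤ) : deg' (D + E) = deg' D + deg' E := by
  unfold deg'
  exact Finsupp.sum_add_index' (fun _ => rfl) (fun _ _ _ => rfl)

omit hK in
lemma deg_single (p : Point) (a : ℤ) : deg' (Finsupp.single p a) = a := by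
  unfold deg'
  simp

lemma rr (D : Point →₀ ℤ) (h : 2 * (genus : ℤ) - 2 < deg' D) :
    (Module.finrank k (LD hK D) : ℤ) = deg' D + 1 - genus := by
  rw [deg', ← hK.riemann_roch D h]
  have : {f : K | f = 0 ∨ ∀ p : Point, -(D p) ≤ v p f} = (LD hK D : Set K) := by
    ext f
    simp only [Set.mem_setOf_eq, SetLike.mem_coe, mem_LD, mem_Lv]
    constructor
    · rintro (h | h) p
      · exact Or.inl h
      · exact Or.inr (h p)
    · intro h
      by_cases hf : f = 0
      · exact Or.inl hf
      · right; intro p; exact (h p).resolve_left hf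
  rw [this, Submodule.span_eq]

lemma rr_fin (D : Point →₀ ℤ) (h : 2 * (genus : ℤ) ≤ deg' D) : Module.Finite k (LD hK D) := by
  apply Module.finite_of_finrank_pos
  have := rr hK D (by omega)
  omega

lemma LD_sub (D : Point →₀ ℤ) (p : Point) : LD hK (D + Finsupp.single p (-1)) ≤ LD hK D := by
  intro f hf
  rw [mem_LD] at hf ⊢
  intro q
  refine Lv_mono hK ?_ (hf q)
  rw [Finsupp.add_apply, Finsupp.single_apply]
  split_ifs <;> omega

lemma LD_sub_mem (D : Point →₀ ℤ) (p : Point) (f : K) (hf : f ∈ LD hK D)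
    (h : f ∈ Lv hK p (-(D p) + 1)) : f ∈ LD hK (D + Finsupp.single p (-1)) := by
  rw [mem_LD] at hf ⊢
  intro q
  rw [Finsupp.add_apply, Finsupp.single_apply]
  split_ifs with hq
  · subst hq
    rw [show -(D p + -1) = -(D p) + 1 by ring]
    exact h
  · simpa using hf q

lemma rr_ex (D : Point →₀ ℤ) (p : Point) (h : 2 * (genus : ℤ) ≤ deg' D) :
    ∃ f : K, f ≠ 0 ∧ v p f = -(D p) ∧ f ∈ LD hK D := by
  haveI := rr_fin hK D h
  have h1 := rr hK D (by omega)
  have h2 := rr hK (D + Finsupp.single p (-1)) (by rw [deg_add, deg_single]; omega)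
  rw [deg_add, deg_single] at h2
  by_contra hcon
  push Not at hcon
  have : LD hK D = LD hK (D + Finsupp.single p (-1)) := by
    refine le_antisymm ?_ (LD_sub hK D p)
    intro f hf
    by_cases hf0 : f = 0
    · rw [hf0]; exact Submodule.zero_mem _
    apply LD_sub_mem hK D p f hf
    rw [mem_Lv' hK hf0]
    have h3 := (mem_LD hK).1 hf p
    rw [mem_Lv' hK hf0] at h3
    have h4 : v p f ≠ -(D p) := fun h => hcon f hf0 h hf
    omega
  rw [this] at h1
  omega

lemma exists_ne (p : Point) : ∃ q, q ≠ p := by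
  by_contra h
  push Not at h
  obtain ⟨f, hf, hv⟩ := hK.exists_uniformizer p
  have := sum_of_subset hK f hf {p} (fun q _ => by simp [h q])
  simp [hv] at this

/-- effective divisor away from `p` making everything regular. -/
lemma exists_div (p q : Point) (hq : q ≠ p) (f : K) (hf : f ≠ 0) (B : ℤ) :
    ∃ D : Point →₀ ℤ, D p = 0 ∧ (∀ r, 0 ≤ D r) ∧ (∀ r ≠ p, -(D r) ≤ v r f) ∧ B ≤ deg' D := by
  let T := (hK.finite_support f hf).toFinset
  let D0 : Point →₀ ℤ := Finsupp.onFinset (T.erase p)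
    (fun r => if r ∈ T.erase p then |v r f| else 0) (by intro r hr; by_contra h; simp [h] at hr)
  have hD0 : ∀ r, 0 ≤ D0 r := by
    intro r; simp only [D0, Finsupp.onFinset_apply]; split_ifs <;> simp
  have hdeg : 0 ≤ deg' D0 := Finset.sum_nonneg fun r _ => hD0 r
  refine ⟨D0 + Finsupp.single q |B|, ?_, ?_, ?_, ?_⟩
  · simp [D0, hq]
  · intro r
    rw [Finsupp.add_apply, Finsupp.single_apply]
    have := hD0 r
    split_ifs
    · positivity
    · simpa using this
  · intro r hr
    have h1 : -(D0 r) ≤ v r f := by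
      simp only [D0, Finsupp.onFinset_apply]
      split_ifs with h
      · exact neg_abs_le _
      · have : v r f = 0 := by
          by_contra h2
          exact h (by simp [T, hr, h2])
        omega
    have h2 : 0 ≤ (Finsupp.single q |B|) r := by
      rw [Finsupp.single_apply]; split_ifs <;> positivity
    rw [Finsupp.add_apply]; omega
  · rw [deg_add, deg_single]
    have := le_abs_self B
    omega

lemma residue (p : Point) (f : K) (hf : f ∈ Lv hK p 0) : ∃ c : k, f - algebraMap k K c ∈ Lv hK p 1 := by
  by_cases hf0 : f = 0
  · exact ⟨0, by simp [hf0]⟩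
  obtain ⟨q, hq⟩ := exists_ne hK p
  obtain ⟨D, hDp, hD0, hDf, hdeg⟩ := exists_div hK p q hq f hf0 (2 * genus)
  have hfD : f ∈ LD hK D := by
    rw [mem_LD]; intro r
    by_cases hr : r = p
    · subst hr; rw [hDp]; simpa using hf
    · exact Or.inr (hDf r hr)
  have h1D : (1 : K) ∈ LD hK D := by
    rw [mem_LD]; intro r
    right; rw [hK.v_one]; have := hD0 r; omega
  have h1D' : (1 : K) ∉ LD hK (D + Finsupp.single p (-1)) := by
    rw [mem_LD]; intro h
    have := h p
    rw [mem_Lv' hK one_ne_zero, hK.v_one] at this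
    simp [hDp] at this
  haveI := rr_fin hK D hdeg
  have e1 := rr hK D (by omega)
  have e2 := rr hK (D + Finsupp.single p (-1)) (by rw [deg_add, deg_single]; omega)
  rw [deg_add, deg_single] at e2
  have hle : LD hK (D + Finsupp.single p (-1)) ⊔ Submodule.span k {(1 : K)} ≤ LD hK D := by
    apply sup_le (LD_sub hK D p)
    rw [Submodule.span_le]; simpa using h1D
  have heq : LD hK (D + Finsupp.single p (-1)) ⊔ Submodule.span k {(1 : K)} = LD hK D := by
    apply Submodule.eq_of_le_of_finrank_le hle
    haveI : Module.Finite k ↥(LD hK (D + Finsupp.single p (-1)) ⊔ Submodule.span k {(1 : K)}) :=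
      Submodule.finiteDimensional_of_le hle
    have hlt : LD hK (D + Finsupp.single p (-1)) < LD hK (D + Finsupp.single p (-1)) ⊔ Submodule.span k {(1 : K)} := by
      refine lt_of_le_of_ne le_sup_left ?_
      intro h
      apply h1D'
      rw [h]
      exact Submodule.mem_sup_right (Submodule.mem_span_singleton_self _)
    have := Submodule.finrank_lt_finrank_of_lt hlt
    omega
  rw [← heq] at hfD
  obtain ⟨x, hx, y, hy, hxy⟩ := Submodule.mem_sup.1 hfD
  obtain ⟨c, rfl⟩ := Submodule.mem_span_singleton.1 hy
  refine ⟨c, ?_⟩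
  have : f - algebraMap k K c = x := by
    rw [← hxy, Algebra.algebraMap_eq_smul_one]; ring
  rw [this]
  have := (mem_LD hK).1 hx p
  simpa [hDp] using this

/-- numerators and denominators prime to `p`, regular away from `P` -/
lemma exists_denom (P p : Point) (hp : p ≠ P) (f : K) (hf : f ≠ 0) :
    ∃ b : K, b ≠ 0 ∧ v p b = 0 ∧ (∀ q ≠ P, 0 ≤ v q b) ∧ ∀ q ≠ P, q ≠ p → 0 ≤ v q (f * b) := by
  obtain ⟨D, hDp, hD0, hDf, -⟩ := exists_div hK p P hp.symm f hf 0
  let E : Point →₀ ℤ := -D + Finsupp.single P (2 * genus + deg' D + D P)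
  have hdegn : deg' (-D) = - deg' D := by
    have := deg_add D (-D)
    rw [add_neg_cancel] at this
    have h0 : deg' (0 : Point →₀ ℤ) = 0 := by simp [deg']
    omega
  obtain ⟨b, hb, hv, hbE⟩ := rr_ex hK E p (by
    simp only [E]; rw [deg_add, deg_single, hdegn]; have := hD0 P; omega)
  rw [mem_LD] at hbE
  have hbE' : ∀ q ≠ P, D q ≤ v q b := by
    intro q hq
    have := hbE q
    rw [mem_Lv' hK hb] at this
    simpa [E, hq.symm] using this
  refine ⟨b, hb, ?_, fun q hq => (hD0 q).trans (hbE' q hq), ?_⟩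
  · rw [hv]; simp [E, hDp, hp.symm]
  · intro q hq hqp
    rw [hK.v_mul q f b hf hb]
    have := hbE' q hq
    have := hDf q hqp
    omega
end Val
end Part3
end FunctionFieldGCD

namespace FunctionFieldGCD
section Part4
section Pole
open Polynomial
variable {k K Point : Type*} [Field k] [Field K] [Algebra k K]
  {v : Point → K → ℤ} {genus : ℕ} (hK : IsFunctionField k v genus)

/-- functions regular away from `P` -/
def OP (P : Point) : Subalgebra k K where
  carrier := {f | ∀ q ≠ P, f ∈ Lv hK q 0}
  mul_mem' := fun {f g} hf hg q hq => by simpa using Lv_mul hK (hf q hq) (hg q hq)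
  add_mem' := fun {f g} hf hg q hq => Submodule.add_mem _ (hf q hq) (hg q hq)
  algebraMap_mem' := fun c q _ => Lv_const hK c

lemma mem_OP {P : Point} {f : K} : f ∈ OP hK P ↔ ∀ q ≠ P, f ∈ Lv hK q 0 := Iff.rfl

lemma OP_pole {P : Point} {f : K} (hf : f ∈ OP hK P) (hf0 : f ≠ 0) : v P f ≤ 0 := by
  have h := sum_of_subset hK f hf0 (insert P (hK.finite_support f hf0).toFinset) (by
    intro p hp; simp [hp])
  rw [← Finset.add_sum_erase _ _ (Finset.mem_insert_self P _)] at h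
  have : 0 ≤ ∑ p ∈ (insert P (hK.finite_support f hf0).toFinset).erase P, v p f := by
    apply Finset.sum_nonneg
    intro q hq
    exact (mem_Lv' hK hf0).1 (hf q (Finset.ne_of_mem_erase hq))
  omega

lemma OP_ex (P : Point) (N : ℕ) (hN : 2 * genus ≤ N) : ∃ f ∈ OP hK P, f ≠ 0 ∧ v P f = -(N : ℤ) := by
  obtain ⟨f, hf0, hv, hf⟩ := rr_ex hK (Finsupp.single P (N : ℤ)) P (by rw [deg_single]; exact_mod_cast hN)
  refine ⟨f, ?_, hf0, by simpa using hv⟩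
  intro q hq
  have := (mem_LD hK).1 hf q
  simpa [Finsupp.single_apply, hq.symm] using this

structure PD (P : Point) where
  e : ℕ
  he : 0 < e
  t : K
  ht0 : t ≠ 0
  htO : t ∈ OP hK P
  hvt : v P t = -(e : ℤ)
  y : Fin e → K
  w : Fin e → ℕ
  hy0 : ∀ i, y i ≠ 0
  hyO : ∀ i, y i ∈ OP hK P
  hvy : ∀ i, v P (y i) = -(w i : ℤ)
  hwm : ∀ i, w i % e = i
  hmin : ∀ f ∈ OP hK P, f ≠ 0 → ∀ N : ℕ, v P f = -(N : ℤ) → w ⟨N % e, Nat.mod_lt _ he⟩ ≤ N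

lemma exists_PD (P : Point) : Nonempty (PD hK P) := by
  set e := 2 * genus + 1 with he
  have he0 : 0 < e := by omega
  obtain ⟨t, htO, ht0, hvt⟩ := OP_ex hK P e (by omega)
  have hex : ∀ i : Fin e, ∃ N : ℕ, N % e = i ∧ ∃ f ∈ OP hK P, f ≠ 0 ∧ v P f = -(N : ℤ) := by
    intro i
    exact ⟨e + i, by simp [Nat.mod_eq_of_lt i.2], OP_ex hK P _ (by omega)⟩
  have hsp := fun i => Nat.find_spec (hex i)
  choose y hyO hy0 hvy using fun i => (hsp i).2
  exact ⟨{ e := e, he := he0, t := t, ht0 := ht0, htO := htO, hvt := hvt, y := y,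
           w := fun i => Nat.find (hex i), hy0 := hy0, hyO := hyO, hvy := hvy
           hwm := fun i => (hsp i).1
           hmin := fun f hf hf0 N hN => Nat.find_min' (hex ⟨N % e, Nat.mod_lt _ he0⟩) ⟨rfl, f, hf, hf0, hN⟩ }⟩

variable {hK} {P : Point} (A : PD hK P)
namespace PD

lemma v_smul (hK : IsFunctionField k v genus) (p : Point) (c : k) (hc : c ≠ 0) (f : K) (hf : f ≠ 0) : v p (c • f) = v p f := by
  rw [Algebra.smul_def, hK.v_mul p _ _ (by simpa using hc) hf, hK.v_algebraMap p c hc, zero_add]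

lemma aeval_sum (c : k[X]) : aeval A.t c = ∑ j ∈ c.support, c.coeff j • A.t ^ j := by
  rw [aeval_def, eval₂_eq_sum, Polynomial.sum]
  exact Finset.sum_congr rfl fun j _ => by rw [Algebra.smul_def]

lemma aeval_v (c : k[X]) (hc : c ≠ 0) :
    aeval A.t c ≠ 0 ∧ v P (aeval A.t c) = -(A.e * c.natDegree : ℤ) := by
  have ht0 := A.ht0
  have he := A.he
  have hv : ∀ j ∈ c.support, v P (c.coeff j • A.t ^ j) = -(A.e * j : ℤ) := by
    intro j hj
    rw [v_smul hK P _ (mem_support_iff.1 hj) _ (pow_ne_zero _ ht0), v_pow hK P _ ht0, A.hvt]; ring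
  have hne : ∀ j ∈ c.support, c.coeff j • A.t ^ j ≠ 0 := fun j hj =>
    smul_ne_zero (mem_support_iff.1 hj) (pow_ne_zero _ ht0)
  obtain ⟨h0, hle⟩ := sum_distinct hK P c.support (fun j => c.coeff j • A.t ^ j) hne (by
    intro i hi j hj h
    simp only [hv i hi, hv j hj] at h
    have h2 : (A.e : ℤ) * i = A.e * j := by omega
    have h3 : (i : ℤ) = j := mul_left_cancel₀ (by exact_mod_cast he.ne') h2
    exact_mod_cast h3) c.natDegree (natDegree_mem_support_of_nonzero hc)
  rw [hv _ (natDegree_mem_support_of_nonzero hc)] at hle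
  rw [← A.aeval_sum] at h0 hle
  refine ⟨h0, le_antisymm hle ?_⟩
  have : aeval A.t c ∈ Lv hK P (-(A.e * c.natDegree : ℤ)) := by
    rw [A.aeval_sum]
    apply Submodule.sum_mem
    intro j hj
    right
    rw [hv j hj]
    have : j ≤ c.natDegree := le_natDegree_of_mem_supp j hj
    gcongr
  exact (mem_Lv' hK h0).1 this

lemma aeval_OP (c : k[X]) : aeval A.t c ∈ OP hK P := by
  have := (aeval (⟨A.t, A.htO⟩ : OP hK P) c).2
  rwa [← Subalgebra.val_apply, ← aeval_algHom_apply] at this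

lemma comb (c : Fin A.e → k[X]) (i : Fin A.e) (hi : c i ≠ 0) :
    ∑ j, aeval A.t (c j) * A.y j ≠ 0 ∧
      v P (∑ j, aeval A.t (c j) * A.y j) ≤ -(A.e * (c i).natDegree + A.w i : ℤ) := by
  have hne : ∀ j, c j ≠ 0 → aeval A.t (c j) * A.y j ≠ 0 := fun j hj =>
    mul_ne_zero (A.aeval_v _ hj).1 (A.hy0 j)
  have hv : ∀ j, c j ≠ 0 → v P (aeval A.t (c j) * A.y j) = -(A.e * (c j).natDegree + A.w j : ℤ) := by
    intro j hj
    rw [hK.v_mul P _ _ (A.aeval_v _ hj).1 (A.hy0 j), (A.aeval_v _ hj).2, A.hvy]; ring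
  have hsum : ∑ j, aeval A.t (c j) * A.y j = ∑ j ∈ Finset.univ.filter (fun j => c j ≠ 0), aeval A.t (c j) * A.y j := by
    rw [Finset.sum_filter]
    apply Finset.sum_congr rfl
    intro j _
    split_ifs with h
    · rfl
    · rw [not_not.1 h]; simp
  have := sum_distinct hK P (Finset.univ.filter (fun j => c j ≠ 0)) (fun j => aeval A.t (c j) * A.y j)
    (fun j hj => hne j (Finset.mem_filter.1 hj).2) (by
      intro a ha b hb h
      have ha := (Finset.mem_filter.1 ha).2
      have hb := (Finset.mem_filter.1 hb).2
      simp only [hv a ha, hv b hb] at h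
      have h2 : A.e * (c a).natDegree + A.w a = A.e * (c b).natDegree + A.w b := by
        zify; omega
      have h3 := congrArg (· % A.e) h2
      simp only [Nat.mul_add_mod, A.hwm] at h3
      exact Fin.ext h3) i (by simp [hi])
  rw [← hsum] at this
  rwa [hv i hi] at this

lemma spanning (f : K) (hf : f ∈ OP hK P) : ∃ c : Fin A.e → k[X], f = ∑ j, aeval A.t (c j) * A.y j := by
  have key : ∀ N : ℕ, ∀ f ∈ OP hK P, f ∈ Lv hK P (-(N : ℤ) + 1) →
      ∃ c : Fin A.e → k[X], f = ∑ j, aeval A.t (c j) * A.y j := by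
    intro N
    induction N with
    | zero =>
      intro f hf hfL
      by_cases hf0 : f = 0
      · exact ⟨0, by simp [hf0]⟩
      have h1 := OP_pole hK hf hf0
      rw [mem_Lv' hK hf0] at hfL
      simp at hfL
      omega
    | succ N ih =>
      intro f hf hfL
      by_cases hf0 : f = 0
      · exact ⟨0, by simp [hf0]⟩
      have h1 := OP_pole hK hf hf0
      rw [mem_Lv' hK hf0] at hfL
      obtain ⟨m, hm⟩ : ∃ m : ℕ, v P f = -(m : ℤ) := ⟨(- v P f).toNat, by omega⟩
      have hmw := A.hmin f hf hf0 m hm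
      set i : Fin A.e := ⟨m % A.e, Nat.mod_lt _ A.he⟩ with hi
      obtain ⟨a, ha⟩ : ∃ a, m = A.e * a + A.w i := by
        have : A.w i ≡ m [MOD A.e] := by
          unfold Nat.ModEq
          rw [A.hwm i]
        obtain ⟨a, ha⟩ := (Nat.modEq_iff_dvd' hmw).1 this
        exact ⟨a, by omega⟩
      set z := A.t ^ a * A.y i with hz
      have hz0 : z ≠ 0 := mul_ne_zero (pow_ne_zero _ A.ht0) (A.hy0 i)
      have hvz : v P z = v P f := by
        rw [hz, hK.v_mul P _ _ (pow_ne_zero _ A.ht0) (A.hy0 i), v_pow hK P _ A.ht0, A.hvt, A.hvy, hm, ha]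
        push_cast; ring
      obtain ⟨c, hc⟩ := residue hK P (f / z) (by
        have := Lv_div hK (Lv_self hK (p := P) f) hz0
        rwa [hvz, sub_self] at this)
      have hg : f - c • z ∈ Lv hK P (-(N : ℤ) + 1) := by
        have := Lv_mul hK hc (Lv_self hK z)
        rw [sub_mul, div_mul_cancel₀ _ hz0, ← Algebra.smul_def] at this
        refine Lv_mono hK ?_ this
        rw [hvz]; push_cast at hfL; omega
      have hzO : z ∈ OP hK P := mul_mem (pow_mem A.htO a) (A.hyO i)
      obtain ⟨d, hd⟩ := ih (f - c • z) (sub_mem hf ((OP hK P).smul_mem hzO c)) hg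
      refine ⟨fun j => d j + if j = i then C c * X ^ a else 0, ?_⟩
      have : ∀ j, aeval A.t (d j + if j = i then C c * X ^ a else 0) * A.y j
          = aeval A.t (d j) * A.y j + if j = i then c • z else 0 := by
        intro j
        split_ifs with h
        · subst h
          simp [add_mul, hz, Algebra.smul_def, mul_assoc]
        · simp
      simp only [this, Finset.sum_add_distrib, ← hd]
      simp
  by_cases hf0 : f = 0
  · exact ⟨0, by simp [hf0]⟩
  apply key ((-v P f).toNat + 1) f hf
  right
  push_cast
  omega

lemma sum_w : 2 * ∑ i, A.w i ≤ A.e * (2 * genus + (A.e - 1)) := by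
  have he := A.he
  set q : Fin A.e → ℕ := fun i => A.w i / A.e with hq
  have hw : ∀ i, A.w i = A.e * q i + i := fun i => by
    have := Nat.div_add_mod (A.w i) A.e
    rw [A.hwm i] at this
    exact this.symm
  set L := ∑ i, q i + 2 * genus + 1 with hL
  have hqL : ∀ i, q i ≤ L := fun i => by
    have := Finset.single_le_sum (f := q) (fun _ _ => Nat.zero_le _) (Finset.mem_univ i)
    omega
  have hLe : L ≤ A.e * L := Nat.le_mul_of_pos_left _ he
  let s : Finset K := (Finset.univ.sigma fun i : Fin A.e => Finset.range (L - q i)).image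
    (fun x => A.t ^ x.2 * A.y x.1)
  have hs : s.card ≤ ∑ i, (L - q i) := by
    refine Finset.card_image_le.trans ?_
    simp
  set D : Point →₀ ℤ := Finsupp.single P ((A.e * L : ℤ) - 1) with hD
  have hdeg : deg' D = A.e * L - 1 := deg_single _ _
  have hLe' : (L : ℤ) ≤ A.e * L := by exact_mod_cast hLe
  have h1 := rr hK D (by rw [hdeg]; omega)
  have hle : LD hK D ≤ Submodule.span k (s : Set K) := by
    intro f hf
    by_cases hf0 : f = 0
    · rw [hf0]; exact Submodule.zero_mem _
    rw [mem_LD] at hf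
    have hfO : f ∈ OP hK P := by
      intro r hr
      have := hf r
      simpa [hD, Finsupp.single_apply, hr.symm] using this
    have hfP : -((A.e * L : ℤ) - 1) ≤ v P f := by
      have := (mem_Lv' hK hf0).1 (hf P)
      simpa [hD] using this
    obtain ⟨c, hc⟩ := A.spanning f hfO
    rw [hc]
    apply Submodule.sum_mem
    intro i _
    by_cases hci : c i = 0
    · rw [hci]; simp
    have h2 := (A.comb c i hci).2
    rw [← hc] at h2
    have h3 : (A.e : ℤ) * (c i).natDegree + A.w i ≤ A.e * L - 1 := by omega
    have h4 : A.e * ((c i).natDegree + q i) < A.e * L := by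
      have := hw i
      zify at this ⊢
      nlinarith
    have h5 : (c i).natDegree + q i < L := lt_of_mul_lt_mul_left h4 (Nat.zero_le _)
    rw [A.aeval_sum, Finset.sum_mul]
    apply Submodule.sum_mem
    intro j hj
    rw [smul_mul_assoc]
    apply Submodule.smul_mem
    apply Submodule.subset_span
    simp only [s, Finset.coe_image, Set.mem_image, Finset.mem_coe, Finset.mem_sigma, Finset.mem_univ, true_and, Finset.mem_range]
    have := le_natDegree_of_mem_supp j hj
    exact ⟨⟨i, j⟩, by simp only; omega, rfl⟩
  have h2 : Module.finrank k (LD hK D) ≤ ∑ i, (L - q i) := by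
    refine (Submodule.finrank_mono hle).trans ((finrank_span_finset_le_card s).trans hs)
  have h3 : (∑ i, (L - q i) : ℕ) + ∑ i, q i = A.e * L := by
    rw [← Finset.sum_add_distrib]
    rw [Finset.sum_congr rfl (fun i _ => Nat.sub_add_cancel (hqL i))]
    simp
  have h4 : ∑ i, q i ≤ genus := by
    zify at h2 h3 ⊢
    rw [h1, hdeg] at h2
    linarith
  have h5 : ∑ i, A.w i = A.e * ∑ i, q i + ∑ i : Fin A.e, (i : ℕ) := by
    rw [Finset.mul_sum, ← Finset.sum_add_distrib]
    exact Finset.sum_congr rfl fun i _ => hw i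
  have h6 : (∑ i : Fin A.e, (i : ℕ)) * 2 = A.e * (A.e - 1) := by
    rw [Fin.sum_univ_eq_sum_range (fun i => i), Finset.sum_range_id_mul_two]
  rw [h5]
  have h7 : A.e * ∑ i, q i ≤ A.e * genus := Nat.mul_le_mul_left _ h4
  rw [mul_add]
  nlinarith
end PD
end Pole
end Part4
end FunctionFieldGCD

namespace FunctionFieldGCD
section Part5
section Ram
open Polynomial
variable {k K Point : Type*} [Field k] [Field K] [Algebra k K]
  {v : Point → K → ℤ} {genus : ℕ} {hK : IsFunctionField k v genus} {P : Point} (A : PD hK P)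
namespace PD

lemma sub_ne (c : k) : A.t - algebraMap k K c ≠ 0 ∧ v P (A.t - algebraMap k K c) = -(A.e : ℤ) := by
  have := A.aeval_v (X - C c) (X_sub_C_ne_zero c)
  simpa using this

lemma sub_OP (c : k) : A.t - algebraMap k K c ∈ OP hK P :=
  sub_mem A.htO ((OP hK P).algebraMap_mem c)

/-- the fibre over `c` -/
noncomputable def Z (c : k) : Finset Point :=
  (hK.finite_support _ (A.sub_ne c).1).toFinset.filter (fun p => p ≠ P)

lemma mem_Z (c : k) (p : Point) : p ∈ A.Z c ↔ p ≠ P ∧ 0 < v p (A.t - algebraMap k K c) := by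
  unfold Z
  simp only [Finset.mem_filter, Set.Finite.mem_toFinset, Set.mem_setOf_eq]
  constructor
  · rintro ⟨h1, h2⟩
    have := (mem_Lv' hK (A.sub_ne c).1).1 (A.sub_OP c p h2)
    exact ⟨h2, by omega⟩
  · rintro ⟨h1, h2⟩
    exact ⟨by omega, h1⟩

lemma sum_Z (c : k) : ∑ p ∈ A.Z c, v p (A.t - algebraMap k K c) = A.e := by
  have h := sum_of_subset hK _ (A.sub_ne c).1 (insert P (A.Z c)) (by
    intro p hp
    by_cases h : p = P
    · simp [h]
    rw [Finset.mem_insert]; right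
    rw [mem_Z]
    have := (mem_Lv' hK (A.sub_ne c).1).1 (A.sub_OP c p h)
    exact ⟨h, by omega⟩)
  rw [Finset.sum_insert (by rw [mem_Z]; simp), (A.sub_ne c).2] at h
  omega

lemma card_Z (c : k) : (A.Z c).card ≤ A.e := by
  have h := A.sum_Z c
  have : ∑ p ∈ A.Z c, (1 : ℤ) ≤ ∑ p ∈ A.Z c, v p (A.t - algebraMap k K c) :=
    Finset.sum_le_sum fun p hp => by have := ((A.mem_Z c p).1 hp).2; omega
  simp at this
  omega

@[reducible] noncomputable def alg : Algebra k[X] (OP hK P) :=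
  (aeval (⟨A.t, A.htO⟩ : OP hK P)).toRingHom.toAlgebra

lemma coe_smul (c : k[X]) (x : OP hK P) : letI := A.alg
    ((c • x : OP hK P) : K) = aeval A.t c * x := by
  letI := A.alg
  rw [Algebra.smul_def]
  have : algebraMap k[X] (OP hK P) c = aeval (⟨A.t, A.htO⟩ : OP hK P) c := rfl
  rw [this, MulMemClass.coe_mul]
  congr 1
  rw [← Subalgebra.val_apply, ← aeval_algHom_apply]; rfl

lemma coe_sum (c : Fin A.e → k[X]) : letI := A.alg
    ((∑ i, c i • (⟨A.y i, A.hyO i⟩ : OP hK P) : OP hK P) : K) = ∑ i, aeval A.t (c i) * A.y i := by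
  letI := A.alg
  rw [AddSubmonoidClass.coe_finset_sum]
  exact Finset.sum_congr rfl fun i _ => by rw [A.coe_smul]

noncomputable def basis : letI := A.alg; Module.Basis (Fin A.e) k[X] (OP hK P) := by
  letI := A.alg
  refine Module.Basis.mk (v := fun i => (⟨A.y i, A.hyO i⟩ : OP hK P)) ?_ ?_
  · rw [Fintype.linearIndependent_iff]
    intro c hc i
    by_contra hi
    apply (A.comb c i hi).1
    rw [← A.coe_sum, hc]; rfl
  · rintro x -
    obtain ⟨c, hc⟩ := A.spanning x x.2
    have : x = ∑ i, c i • (⟨A.y i, A.hyO i⟩ : OP hK P) := by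
      apply Subtype.ext
      rw [A.coe_sum, hc]
    rw [this]
    exact Submodule.sum_mem _ fun i _ => Submodule.smul_mem _ _ (Submodule.subset_span ⟨i, rfl⟩)

lemma basis_apply (i : Fin A.e) : letI := A.alg; A.basis i = ⟨A.y i, A.hyO i⟩ := by
  letI := A.alg
  exact Module.Basis.mk_apply _ _ _

lemma repr_bound (u : OP hK P) (N : ℕ) (hu : (u : K) ∈ Lv hK P (-(N : ℤ))) (i : Fin A.e) : letI := A.alg
    A.basis.repr u i ≠ 0 → A.e * (A.basis.repr u i).natDegree + A.w i ≤ N := by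
  letI := A.alg
  intro hi
  have h := A.comb (fun j => A.basis.repr u j) i hi
  have h2 : ∑ j, aeval A.t (A.basis.repr u j) * A.y j = u := by
    rw [← A.coe_sum]
    simp only [← A.basis_apply]
    rw [A.basis.sum_repr]
  rw [h2] at h
  have := (mem_Lv' hK h.1).1 hu
  have := h.2
  zify
  omega

lemma trace_bound (u : OP hK P) (N : ℕ) (hu : (u : K) ∈ Lv hK P (-(N : ℤ))) : letI := A.alg
    A.e * (Algebra.trace k[X] (OP hK P) u).natDegree ≤ N := by
  letI := A.alg
  rw [mul_comm, ← Nat.le_div_iff_mul_le A.he, Algebra.trace_eq_matrix_trace A.basis, Matrix.trace]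
  apply Polynomial.natDegree_sum_le_of_forall_le
  intro i _
  rw [Matrix.diag_apply, Algebra.leftMulMatrix_eq_repr_mul, Nat.le_div_iff_mul_le A.he, mul_comm]
  by_cases h : A.basis.repr (u * A.basis i) i = 0
  · rw [h]; simp
  have := A.repr_bound (u * A.basis i) (N + A.w i) (by
    rw [A.basis_apply]
    have := Lv_mul hK hu (Lv_self hK (p := P) (A.y i))
    rw [A.hvy] at this
    push_cast
    rw [neg_add]
    exact this) i h
  omega

lemma dvd_trace (c : k) (z : OP hK P) (hz : ∀ p ∈ A.Z c, (z : K) ∈ Lv hK p 1) : letI := A.alg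
    (X - C c) ∣ Algebra.trace k[X] (OP hK P) z := by
  letI := A.alg
  obtain ⟨h0, hv⟩ := A.sub_ne c
  have hz' : ∃ z' : OP hK P, z ^ A.e = (X - C c : k[X]) • z' := by
    refine ⟨⟨(z : K) ^ A.e / (A.t - algebraMap k K c), ?_⟩, ?_⟩
    · intro q hq
      have h1 : (z : K) ^ A.e ∈ Lv hK q (v q (A.t - algebraMap k K c)) := by
        by_cases hqZ : q ∈ A.Z c
        · have h2 := Lv_pow hK (hz q hqZ) A.e
          refine Lv_mono hK ?_ h2
          rw [mul_one, ← A.sum_Z c]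
          exact Finset.single_le_sum (f := fun p => v p (A.t - algebraMap k K c))
            (fun p hp => ((A.mem_Z c p).1 hp).2.le) hqZ
        · rw [mem_Z] at hqZ
          push Not at hqZ
          have h2 := Lv_pow hK (z.2 q hq) A.e
          exact Lv_mono hK (by simpa using hqZ hq) h2
      have := Lv_div hK h1 h0
      rwa [sub_self] at this
    · apply Subtype.ext
      rw [A.coe_smul]
      simp only [map_sub, aeval_X, aeval_C]
      rw [mul_div_cancel₀ _ h0]; rfl
  obtain ⟨z', hz'⟩ := hz'
  rw [dvd_iff_isRoot, Algebra.trace_eq_matrix_trace A.basis]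
  set Mz := Algebra.leftMulMatrix A.basis z
  have hn : IsNilpotent (Mz.map (evalRingHom c)) := by
    refine ⟨A.e, ?_⟩
    have : (Mz.map (evalRingHom c)) = (evalRingHom c).mapMatrix Mz := rfl
    rw [this, ← map_pow, ← map_pow, hz', map_smul]
    ext i j
    simp
  have := Matrix.isNilpotent_trace_of_isNilpotent hn
  rw [isNilpotent_iff_eq_zero] at this
  rw [IsRoot.def, ← coe_evalRingHom, ← this]
  exact AddMonoidHom.map_trace (evalRingHom c) Mz

lemma ram_dvd [CharZero k] (c : k) : letI := A.alg
    (X - C c) ^ (A.e - (A.Z c).card) ∣ (trM A.basis).det := by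
  letI := A.alg
  have hr : ∀ (i : Fin A.e) (p : A.Z c), ∃ b : k, A.y i - algebraMap k K b ∈ Lv hK p 1 := fun i p =>
    residue hK p (A.y i) (A.hyO i p ((A.mem_Z c p).1 p.2).1)
  choose r hr using hr
  let φ : (Fin A.e → k) →ₗ[k] (A.Z c → k) := (Matrix.of fun p i => r i p).mulVecLin
  have hdim : A.e - (A.Z c).card ≤ Module.finrank k (LinearMap.ker φ) := by
    have h1 := LinearMap.finrank_range_add_finrank_ker φ
    have h2 := Submodule.finrank_le (LinearMap.range φ)
    simp at h1 h2
    omega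
  let B := Module.finBasis k (LinearMap.ker φ)
  let a : Fin (A.e - (A.Z c).card) → Fin A.e → k := fun l => (B (Fin.castLE hdim l) : Fin A.e → k)
  have ha : LinearIndependent k a :=
    (B.linearIndependent.map' (LinearMap.ker φ).subtype (Submodule.ker_subtype _)).comp _
      (Fin.castLE_injective hdim)
  haveI : FaithfulSMul k[X] (OP hK P) := by
    rw [faithfulSMul_iff_algebraMap_injective, injective_iff_map_eq_zero]
    intro x hx
    by_contra h
    apply (A.aeval_v x h).1
    have := A.coe_smul x 1
    rw [Algebra.smul_def, hx] at this
    simpa using this.symm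
  refine trM_order A.basis c a ha ?_
  intro l x
  apply A.dvd_trace
  intro p hp
  have hpP := ((A.mem_Z c p).1 hp).1
  have hu : ((∑ i, (C (a l i) : k[X]) • A.basis i : OP hK P) : K) ∈ Lv hK p 1 := by
    simp only [A.basis_apply]
    rw [A.coe_sum]
    simp only [aeval_C]
    have hker : φ (a l) = 0 := (B (Fin.castLE hdim l)).2
    have hk : ∑ i, r i ⟨p, hp⟩ * a l i = 0 := by
      have := congrFun hker ⟨p, hp⟩
      simpa [φ, Matrix.mulVec, dotProduct] using this
    have : ∑ i, algebraMap k K (a l i) * A.y i = ∑ i, a l i • (A.y i - algebraMap k K (r i ⟨p, hp⟩)) := by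
      simp only [Algebra.smul_def, mul_sub, Finset.sum_sub_distrib, ← map_mul]
      rw [← map_sum]
      have : ∑ i, a l i * r i ⟨p, hp⟩ = 0 := by rw [← hk]; exact Finset.sum_congr rfl fun i _ => mul_comm _ _
      rw [this]; simp
    rw [this]
    exact Submodule.sum_mem _ fun i _ => Submodule.smul_mem _ _ (hr i ⟨p, hp⟩)
  have := Lv_mul hK hu (x.2 p hpP)
  simpa using this

lemma ram [CharZero k] : ∃ R : Finset k, (∀ c ∉ R, A.e = (A.Z c).card) ∧
    ∀ s : Finset k, (∑ c ∈ s, (A.e - (A.Z c).card)) ≤ 2 * genus + (A.e - 1) := by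
  letI := A.alg
  haveI : FaithfulSMul k[X] (OP hK P) := by
    rw [faithfulSMul_iff_algebraMap_injective, injective_iff_map_eq_zero]
    intro x hx
    by_contra h
    apply (A.aeval_v x h).1
    have := A.coe_smul x 1
    rw [Algebra.smul_def, hx] at this
    simpa using this.symm
  obtain ⟨h1, h2⟩ := trM_total A.basis A.e A.he A.w (by
    intro i j
    apply A.trace_bound
    rw [A.basis_apply, A.basis_apply]
    have := Lv_mul hK (Lv_self hK (p := P) (A.y i)) (Lv_self hK (p := P) (A.y j))
    rw [A.hvy, A.hvy] at this
    push_cast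
    rw [neg_add]
    exact this) (fun c => A.e - (A.Z c).card) (fun c => A.ram_dvd c)
  refine ⟨(trM A.basis).det.roots.toFinset, fun c hc => ?_, fun s => ?_⟩
  · by_contra h
    apply hc
    apply h1 c
    have := A.card_Z c
    omega
  · have := (h2 s).trans A.sum_w
    exact le_of_mul_le_mul_left this A.he

end PD
end Ram
end Part5
end FunctionFieldGCD

namespace FunctionFieldGCD
section Part6
section Loc
open Polynomial
variable {k K Point : Type*} [Field k] [Field K] [Algebra k K]
  {v : Point → K → ℤ} {genus : ℕ} (hK : IsFunctionField k v genus)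

lemma v_add_eq (p : Point) (x y : K) (hx : x ≠ 0) (hy : y ∈ Lv hK p (v p x + 1)) :
    x + y ≠ 0 ∧ v p (x + y) = v p x := by
  have h0 : x + y ≠ 0 := by
    intro h
    rw [eq_neg_of_add_eq_zero_right h, mem_Lv' hK (neg_ne_zero.2 hx), v_neg hK p x hx] at hy
    omega
  refine ⟨h0, le_antisymm ?_ ?_⟩
  · by_contra h
    push Not at h
    have : x ∈ Lv hK p (v p x + 1) := by
      have h1 : x = (x + y) - y := by ring
      have h2 : (x + y) - y ∈ Lv hK p (v p x + 1) :=
        Submodule.sub_mem _ ((mem_Lv' hK h0).2 (by omega)) hy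
      rwa [← h1] at h2
    rw [mem_Lv' hK hx] at this
    omega
  · exact (mem_Lv' hK h0).1 (Submodule.add_mem _ (Lv_self hK x) (Lv_mono hK (by omega) hy))

lemma D_improve (D : Derivation k K K) (p : Point) (C : ℤ) (hC : ∀ f ∈ Lv hK p 0, D f ∈ Lv hK p (-C))
    (π : K) (hπ0 : π ≠ 0) (hπ : v p π = 1) (μ : ℤ) (hμ : D π ∈ Lv hK p μ) :
    ∀ f ∈ Lv hK p 0, D f ∈ Lv hK p μ := by
  have key : ∀ j : ℕ, ∀ f ∈ Lv hK p 0, D f ∈ Lv hK p (min μ (j - C)) := by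
    intro j
    induction j with
    | zero => exact fun f hf => Lv_mono hK (by simp) (hC f hf)
    | succ j ih =>
      intro f hf
      obtain ⟨c, hc⟩ := residue hK p f hf
      have hh : (f - algebraMap k K c) / π ∈ Lv hK p 0 := by
        have := Lv_div hK hc hπ0
        rwa [hπ, sub_self] at this
      set h := (f - algebraMap k K c) / π with hdef
      have hf' : f = algebraMap k K c + h * π := by
        rw [hdef, div_mul_cancel₀ _ hπ0]; ring
      have : D f = h * D π + π * D h := by
        conv_lhs => rw [hf']
        rw [map_add, D.map_algebraMap, D.leibniz]
        simp
      rw [this]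
      refine Submodule.add_mem _ (Lv_mono hK ?_ (Lv_mul hK hh hμ))
        (Lv_mono hK ?_ (Lv_mul hK (Lv_self hK π) (ih h hh)))
      · simp
      · rw [hπ]; push_cast
        omega
  intro f hf
  refine Lv_mono hK ?_ (key (μ + C).toNat f hf)
  have := Int.self_le_toNat (μ + C)
  simp; omega

lemma D_loc [CharZero k] (D : Derivation k K K) (hD : ∃ t, D t ≠ 0) (p : Point) (C : ℤ)
    (hC : ∀ f ∈ Lv hK p 0, D f ∈ Lv hK p (-C)) :
    ∃ μ : ℤ, (∀ f ∈ Lv hK p 0, D f ∈ Lv hK p μ) ∧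
      ∀ s, s ≠ 0 → v p s ≠ 0 → D s ≠ 0 ∧ v p (D s) = v p s - 1 + μ := by
  haveI : CharZero K := charZero_of_injective_algebraMap (algebraMap k K).injective
  obtain ⟨π, hπ0, hπ⟩ := hK.exists_uniformizer p
  have hinv : ∀ s : K, s ≠ 0 → D s⁻¹ = -(s⁻¹ ^ 2 * D s) := by
    intro s hs
    rw [D.leibniz_inv]; simp
  have hDπ : D π ≠ 0 := by
    intro h0
    obtain ⟨t, ht⟩ := hD
    have h1 : ∀ f ∈ Lv hK p 0, D f = 0 := by
      intro f hf
      by_contra hne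
      have := D_improve hK D p C hC π hπ0 hπ (v p (D f) + 1) (by rw [h0]; exact Submodule.zero_mem _) f hf
      rw [mem_Lv' hK hne] at this
      omega
    have ht0 : t ≠ 0 := by rintro rfl; simp at ht
    rcases le_total 0 (v p t) with h | h
    · exact ht (h1 t (Or.inr h))
    · have h2 := h1 t⁻¹ (Or.inr (by rw [v_inv hK p t ht0]; omega))
      rw [hinv t ht0] at h2
      simp [ht0, ht] at h2
  have himp := D_improve hK D p C hC π hπ0 hπ (v p (D π)) (Lv_self hK _)
  refine ⟨v p (D π), himp, ?_⟩
  have hpos : ∀ (a : ℕ) (s : K), a ≠ 0 → s ≠ 0 → v p s = a → D s ≠ 0 ∧ v p (D s) = v p s - 1 + v p (D π) := by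
    intro a s ha hs hva
    have hpa : π ^ a ≠ 0 := pow_ne_zero _ hπ0
    set u := s / π ^ a with hu
    have hu0 : u ≠ 0 := div_ne_zero hs hpa
    have hvu : v p u = 0 := by
      rw [hu, v_div hK p _ _ hs hpa, v_pow hK p _ hπ0, hπ, hva]; ring
    have hs' : s = u * π ^ a := by rw [hu, div_mul_cancel₀ _ hpa]
    obtain ⟨b, rfl⟩ : ∃ b, a = b + 1 := ⟨a - 1, by omega⟩
    have hDs : D s = algebraMap k K (b + 1 : k) * (u * (π ^ b * D π)) + π ^ (b + 1) * D u := by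
      conv_lhs => rw [hs']
      rw [D.leibniz, D.leibniz_pow]
      simp
      ring
    have hb : (b + 1 : k) ≠ 0 := by exact_mod_cast Nat.succ_ne_zero b
    have hb' : algebraMap k K (b + 1 : k) ≠ 0 := by
      exact (_root_.map_ne_zero _).2 hb
    have hx0 : algebraMap k K (b + 1 : k) * (u * (π ^ b * D π)) ≠ 0 :=
      mul_ne_zero hb' (mul_ne_zero hu0 (mul_ne_zero (pow_ne_zero _ hπ0) hDπ))
    have hvx : v p (algebraMap k K (b + 1 : k) * (u * (π ^ b * D π))) = b + v p (D π) := by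
      rw [hK.v_mul p _ _ hb' (mul_ne_zero hu0 (mul_ne_zero (pow_ne_zero _ hπ0) hDπ)),
        hK.v_mul p _ _ hu0 (mul_ne_zero (pow_ne_zero _ hπ0) hDπ),
        hK.v_mul p _ _ (pow_ne_zero _ hπ0) hDπ, hK.v_algebraMap p _ hb, hvu, v_pow hK p _ hπ0, hπ]
      ring
    have hy : π ^ (b + 1) * D u ∈ Lv hK p (v p (algebraMap k K (b + 1 : k) * (u * (π ^ b * D π))) + 1) := by
      have := Lv_mul hK (Lv_self hK (p := p) (π ^ (b + 1))) (himp u (Or.inr hvu.ge))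
      refine Lv_mono hK ?_ this
      rw [hvx, v_pow hK p _ hπ0, hπ]; push_cast; linarith
    have := v_add_eq hK p _ _ hx0 hy
    rw [← hDs, hvx] at this
    refine ⟨this.1, ?_⟩
    rw [this.2, hva]; push_cast; ring
  intro s hs hvs
  rcases lt_or_gt_of_ne hvs with h | h
  · have hi := inv_ne_zero hs
    have hvi := v_inv hK p s hs
    obtain ⟨h1, h2⟩ := hpos (-(v p s)).toNat s⁻¹ (by omega) hi (by omega)
    have h3 := hinv s⁻¹ hi
    rw [inv_inv] at h3
    have hs2 : s ^ 2 ≠ 0 := pow_ne_zero _ hs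
    rw [h3, v_neg hK p _ (mul_ne_zero hs2 h1), hK.v_mul p _ _ hs2 h1, h2, v_pow hK p _ hs, hvi]
    exact ⟨neg_ne_zero.2 (mul_ne_zero hs2 h1), by push_cast; ring⟩
  · exact hpos (v p s).toNat s (by omega) hs (by omega)

lemma exists_denom' (P : Point) (f : K) (hf : f ≠ 0) : ∃ b ∈ OP hK P, b ≠ 0 ∧ f * b ∈ OP hK P := by
  obtain ⟨q, hq⟩ := exists_ne hK P
  obtain ⟨D, hDp, hD0, hDf, -⟩ := exists_div hK P q hq f hf 0
  let E : Point →₀ ℤ := -D + Finsupp.single P (2 * genus + deg' D)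
  have hdegn : deg' (-D) = - deg' D := by
    have := deg_add D (-D)
    rw [add_neg_cancel] at this
    simp [deg'] at this ⊢
    linarith
  obtain ⟨b, hb0, -, hb⟩ := rr_ex hK E P (by
    simp only [E]; rw [deg_add, deg_single, hdegn]; linarith)
  rw [mem_LD] at hb
  have hb' : ∀ q ≠ P, D q ≤ v q b := by
    intro q hq
    have := (mem_Lv' hK hb0).1 (hb q)
    simpa [E, Finsupp.single_apply, hq.symm] using this
  refine ⟨b, fun q hq => Or.inr ((hD0 q).trans (hb' q hq)), hb0, fun q hq => Or.inr ?_⟩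
  rw [hK.v_mul q _ _ hf hb0]
  have := hDf q hq
  have := hb' q hq
  omega

variable {hK} {P : Point} (A : PD hK P)
namespace PD

lemma exists_D [CharZero k] : ∃ D : Derivation k K K, D A.t = 1 := by
  letI a1 := A.alg
  letI a2 : Algebra k[X] K := (aeval A.t).toRingHom.toAlgebra
  have h2 : ∀ c : k[X], algebraMap k[X] K c = aeval A.t c := fun _ => rfl
  haveI : IsScalarTower k k[X] K := IsScalarTower.of_algebraMap_eq (fun x => by
    rw [h2, ← Polynomial.C_eq_algebraMap, aeval_C])
  haveI : IsScalarTower k[X] (OP hK P) K := IsScalarTower.of_algebraMap_eq (fun x => by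
    have := A.coe_smul x 1
    rw [Algebra.smul_def] at this
    simp only [mul_one, OneMemClass.coe_one] at this
    rw [h2, ← this]; rfl)
  haveI : FaithfulSMul k[X] K := by
    rw [faithfulSMul_iff_algebraMap_injective, injective_iff_map_eq_zero]
    intro x hx
    by_contra h
    exact (A.aeval_v x h).1 hx
  haveI : Module.Finite k[X] (OP hK P) := Module.Finite.of_basis A.basis
  have hint : ∀ a : K, a ∈ OP hK P → IsAlgebraic k[X] a := by
    intro a ha
    have : IsIntegral k[X] (⟨a, ha⟩ : OP hK P) := Algebra.IsIntegral.isIntegral _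
    have := this.algebraMap (B := K)
    exact this.isAlgebraic
  haveI : Algebra.IsAlgebraic k[X] K := ⟨fun f => by
    by_cases hf : f = 0
    · rw [hf]; exact isAlgebraic_zero
    obtain ⟨b, hb, hb0, hfb⟩ := exists_denom' hK P f hf
    have : f = (f * b) * b⁻¹ := by field_simp
    rw [this]
    exact (hint _ hfb).mul (hint _ hb).inv⟩
  obtain ⟨D, hD⟩ := exists_derivation k K
  exact ⟨D, by rwa [h2, aeval_X] at hD⟩

lemma D_aeval (D : Derivation k K K) (hD : D A.t = 1) (c : k[X]) :
    D (aeval A.t c) = aeval A.t (derivative c) := by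
  rw [D.map_aeval, hD]; simp

lemma exists_C (s : Finset ℤ) : ∃ C : ℤ, 0 ≤ C ∧ ∀ x ∈ s, -C ≤ x := by
  obtain ⟨C, hC⟩ := s.bddBelow
  refine ⟨max 0 (-C), le_max_left _ _, fun x hx => ?_⟩
  have := hC (Finset.mem_coe.2 hx)
  omega

lemma D_fin (D : Derivation k K K) (hD : D A.t = 1) (p : Point) :
    ∃ C : ℤ, ∀ f ∈ Lv hK p 0, D f ∈ Lv hK p (-C) := by
  by_cases hp : p = P
  · subst hp
    obtain ⟨C, hC0, hC⟩ := exists_C (Finset.univ.image fun i => A.w i + v p (D (A.y i)))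
    have hOP : ∀ a ∈ OP hK p, a ≠ 0 → D a ∈ Lv hK p (v p a - C) := by
      intro a ha ha0
      obtain ⟨c, hc⟩ := A.spanning a ha
      have hDa : D a = ∑ j, (aeval A.t (c j) * D (A.y j) + A.y j * aeval A.t (derivative (c j))) := by
        conv_lhs => rw [hc]
        rw [map_sum]
        refine Finset.sum_congr rfl fun j _ => ?_
        rw [D.leibniz, A.D_aeval D hD]; simp
      rw [hDa]
      apply Submodule.sum_mem
      intro j _
      by_cases hj : c j = 0
      · rw [hj]; simp
      have h1 := (A.comb c j hj).2
      rw [← hc] at h1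
      refine Submodule.add_mem _ ?_ ?_
      · refine Lv_mono hK ?_ (Lv_mul hK (Lv_self hK _) (Lv_self hK _))
        rw [(A.aeval_v _ hj).2]
        have := hC _ (Finset.mem_image_of_mem _ (Finset.mem_univ j))
        omega
      · by_cases hj' : derivative (c j) = 0
        · rw [hj']; simp
        refine Lv_mono hK ?_ (Lv_mul hK (Lv_self hK _) (Lv_self hK _))
        rw [(A.aeval_v _ hj').2, A.hvy]
        have : (derivative (c j)).natDegree ≤ (c j).natDegree :=
          (natDegree_derivative_le _).trans (Nat.sub_le _ _)
        have : (A.e : ℤ) * (derivative (c j)).natDegree ≤ A.e * (c j).natDegree := by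
          gcongr
        omega
    refine ⟨C, fun f hf => ?_⟩
    by_cases hf0 : f = 0
    · rw [hf0]; simp
    obtain ⟨b, hb, hb0, hfb⟩ := exists_denom' hK p f hf0
    have h1 := hOP _ hfb (mul_ne_zero hf0 hb0)
    have h2 := hOP _ hb hb0
    rw [mem_Lv' hK hf0] at hf
    rw [hK.v_mul p _ _ hf0 hb0] at h1
    have h3 : D f = (D (f * b) - f * D b) / b := by
      rw [D.leibniz]; field_simp; simp; ring
    rw [h3]
    have h4 : D (f * b) - f * D b ∈ Lv hK p (v p b - C) := by
      refine Submodule.sub_mem _ (Lv_mono hK ?_ h1) (Lv_mono hK ?_ (Lv_mul hK (Lv_self hK f) h2))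
      · omega
      · omega
    refine Lv_mono hK ?_ (Lv_div hK h4 hb0)
    omega
  · obtain ⟨C, hC0, hC⟩ := exists_C (Finset.univ.image fun i => v p (D (A.y i)))
    have hOP : ∀ a ∈ OP hK P, D a ∈ Lv hK p (-C) := by
      intro a ha
      obtain ⟨c, hc⟩ := A.spanning a ha
      have hDa : D a = ∑ j, (aeval A.t (c j) * D (A.y j) + A.y j * aeval A.t (derivative (c j))) := by
        conv_lhs => rw [hc]
        rw [map_sum]
        refine Finset.sum_congr rfl fun j _ => ?_
        rw [D.leibniz, A.D_aeval D hD]; simp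
      rw [hDa]
      apply Submodule.sum_mem
      intro j _
      refine Submodule.add_mem _ ?_ ?_
      · refine Lv_mono hK ?_ (Lv_mul hK (A.aeval_OP _ p hp) (Lv_self hK _))
        have := hC _ (Finset.mem_image_of_mem _ (Finset.mem_univ j))
        omega
      · refine Lv_mono hK ?_ (Lv_mul hK (A.hyO j p hp) (A.aeval_OP _ p hp))
        omega
    refine ⟨C, fun f hf => ?_⟩
    by_cases hf0 : f = 0
    · rw [hf0]; simp
    obtain ⟨b, hb0, hvb, hb, hfb⟩ := exists_denom hK P p hp f hf0
    have h1 := hOP (f * b) (fun q hq => by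
      by_cases hqp : q = p
      · subst hqp
        have := Lv_mul hK hf (Lv_self hK b)
        rwa [hvb, add_zero] at this
      · exact Or.inr (hfb q hq hqp))
    have h2 := hOP b (fun q hq => Or.inr (hb q hq))
    have h3 : D f = (D (f * b) - f * D b) / b := by
      rw [D.leibniz]; field_simp; simp; ring
    rw [h3]
    have h4 : D (f * b) - f * D b ∈ Lv hK p (- C) := by
      refine Submodule.sub_mem _ h1 (Lv_mono hK ?_ (Lv_mul hK hf h2))
      omega
    refine Lv_mono hK ?_ (Lv_div hK h4 hb0)
    omega

end PD

lemma good_derivation [CharZero k] (hK : IsFunctionField k v genus) (P : Point) :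
    ∃ (D : Derivation k K K) (δ : Point → ℤ),
      (∀ p f a, f ∈ Lv hK p a → D f ∈ Lv hK p (a - 1 - δ p)) ∧
      (∀ f, D f = 0 → ∃ c : k, algebraMap k K c = f) ∧ {p | δ p ≠ 0}.Finite ∧
      ∀ T : Finset Point, (∀ p, δ p ≠ 0 → p ∈ T) → ∑ p ∈ T, δ p ≤ 2 * (genus : ℤ) - 2 := by
  obtain ⟨A⟩ := exists_PD hK P
  obtain ⟨D, hD⟩ := A.exists_D
  have hloc : ∀ p, ∃ μ : ℤ, (∀ f ∈ Lv hK p 0, D f ∈ Lv hK p μ) ∧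
      ∀ s, s ≠ 0 → v p s ≠ 0 → D s ≠ 0 ∧ v p (D s) = v p s - 1 + μ := fun p => by
    obtain ⟨C, hC⟩ := A.D_fin D hD p
    exact D_loc hK D ⟨A.t, by rw [hD]; exact one_ne_zero⟩ p C hC
  choose μ hμ1 hμ2 using hloc
  have hres : ∀ p, ∃ c : k, p ≠ P → 0 < v p (A.t - algebraMap k K c) := by
    intro p
    by_cases hp : p = P
    · exact ⟨0, fun h => absurd hp h⟩
    obtain ⟨c, hc⟩ := residue hK p A.t (A.htO p hp)
    refine ⟨c, fun _ => ?_⟩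
    rw [mem_Lv' hK (A.sub_ne c).1] at hc
    omega
  choose c hc using hres
  have hDsub : ∀ c : k, D (A.t - algebraMap k K c) = 1 := by
    intro c; rw [map_sub, hD, D.map_algebraMap, sub_zero]
  have hμp : ∀ p ≠ P, -μ p = v p (A.t - algebraMap k K (c p)) - 1 := by
    intro p hp
    have := (hμ2 p _ (A.sub_ne (c p)).1 (hc p hp).ne').2
    rw [hDsub, hK.v_one] at this
    omega
  have hμP : -μ P = -(A.e + 1 : ℤ) := by
    have he := A.he
    have := (hμ2 P _ (A.sub_ne 0).1 (by rw [(A.sub_ne 0).2]; omega)).2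
    rw [hDsub, hK.v_one, (A.sub_ne 0).2] at this
    omega
  obtain ⟨R, hR1, hR2⟩ := A.ram
  refine ⟨D, fun p => -μ p, ?_, ?_, ?_, ?_⟩
  · intro p f a hf
    beta_reduce
    by_cases hf0 : f = 0
    · rw [hf0]; simp
    rw [mem_Lv' hK hf0] at hf
    by_cases hvf : v p f = 0
    · refine Lv_mono hK ?_ (hμ1 p f (Or.inr hvf.ge))
      omega
    · right
      rw [(hμ2 p f hf0 hvf).2]; omega
  · intro f hf
    by_cases hf0 : f = 0
    · exact ⟨0, by simp [hf0]⟩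
    apply hK.const_of_nonneg f hf0
    intro p
    by_contra h
    exact (hμ2 p f hf0 (by omega)).1 hf
  · refine Set.Finite.subset (insert P (R.biUnion A.Z)).finite_toSet ?_
    intro p hp
    simp only [Set.mem_setOf_eq] at hp
    rw [Finset.mem_coe, Finset.mem_insert]
    by_cases hpP : p = P
    · exact Or.inl hpP
    right
    rw [Finset.mem_biUnion]
    have hpZ : p ∈ A.Z (c p) := (A.mem_Z _ _).2 ⟨hpP, hc p hpP⟩
    refine ⟨c p, ?_, hpZ⟩
    by_contra hR
    have h1 := hR1 _ hR
    have h2 := A.sum_Z (c p)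
    have h3 : ∑ q ∈ A.Z (c p), (v q (A.t - algebraMap k K (c p)) - 1) = 0 := by
      rw [Finset.sum_sub_distrib, h2]; simp [h1]
    have h4 := (Finset.sum_eq_zero_iff_of_nonneg (fun q hq => by
      have := ((A.mem_Z _ _).1 hq).2; omega)).1 h3 p hpZ
    apply hp
    rw [hμp p hpP]; exact h4
  · intro T hT
    have hPT : P ∈ T := hT P (by beta_reduce; rw [hμP]; have := A.he; omega)
    rw [← Finset.add_sum_erase _ _ hPT, hμP]
    have h1 : ∑ p ∈ T.erase P, -μ p ≤ ∑ b ∈ (T.erase P).image c, ((A.e - (A.Z b).card : ℕ) : ℤ) := by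
      rw [← Finset.sum_fiberwise_of_maps_to (g := c) (t := (T.erase P).image c)
        (fun p hp => Finset.mem_image_of_mem c hp)]
      apply Finset.sum_le_sum
      intro b _
      have h2 : ∑ p ∈ A.Z b, (v p (A.t - algebraMap k K b) - 1) = ((A.e - (A.Z b).card : ℕ) : ℤ) := by
        rw [Finset.sum_sub_distrib, A.sum_Z, Nat.cast_sub (A.card_Z b)]; simp
      rw [← h2]
      have h3 : ∑ p ∈ (T.erase P).filter (fun p => c p = b), -μ p =
          ∑ p ∈ (T.erase P).filter (fun p => c p = b), (v p (A.t - algebraMap k K b) - 1) := by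
        apply Finset.sum_congr rfl
        intro p hp
        rw [Finset.mem_filter, Finset.mem_erase] at hp
        rw [hμp p hp.1.1, hp.2]
      rw [h3]
      apply Finset.sum_le_sum_of_subset_of_nonneg
      · intro p hp
        rw [Finset.mem_filter, Finset.mem_erase] at hp
        rw [A.mem_Z, ← hp.2]
        exact ⟨hp.1.1, hc p hp.1.1⟩
      · intro p hp _
        have := ((A.mem_Z _ _).1 hp).2; omega
    have h2 := hR2 ((T.erase P).image c)
    have he := A.he
    rw [← Nat.cast_sum] at h1
    omega

end Loc
end Part6
end FunctionFieldGCD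

namespace FunctionFieldGCD
section Part7
section Plucker
variable {k K Point : Type*} [Field k] [Field K] [Algebra k K]
  {v : Point → K → ℤ} {genus : ℕ} (hK : IsFunctionField k v genus)

lemma iter_Lv (D : Derivation k K K) (p : Point) (δ : ℤ)
    (hD : ∀ f a, f ∈ Lv hK p a → D f ∈ Lv hK p (a - 1 - δ)) (f : K) (a : ℤ) (hf : f ∈ Lv hK p a) (i : ℕ) :
    (D^[i]) f ∈ Lv hK p (a - i * (1 + δ)) := by
  induction i with
  | zero => simpa using hf
  | succ i ih =>
    rw [Function.iterate_succ_apply']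
    have := hD _ _ ih
    convert this using 2
    push_cast; ring

lemma det_Lv (D : Derivation k K K) (p : Point) (δ : ℤ)
    (hD : ∀ f a, f ∈ Lv hK p a → D f ∈ Lv hK p (a - 1 - δ)) {N : ℕ} (f : Fin N → K) (α : Fin N → ℤ)
    (hf : ∀ j, f j ∈ Lv hK p (α j)) :
    (wrM D f).det ∈ Lv hK p (∑ j, α j - (∑ j : Fin N, (j : ℤ)) * (1 + δ)) := by
  rw [Matrix.det_apply]
  apply Submodule.sum_mem
  intro σ _
  have h : ∏ i, (wrM D f) (σ i) i ∈ Lv hK p (∑ j, α j - (∑ j : Fin N, (j : ℤ)) * (1 + δ)) := by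
    have := Lv_prod hK Finset.univ (fun i => (wrM D f) (σ i) i) (fun i => α i - ((σ i : ℕ) : ℤ) * (1 + δ))
      (fun i _ => iter_Lv hK D p δ hD _ _ (hf i) _)
    rw [Finset.sum_sub_distrib, ← Finset.sum_mul, Equiv.sum_comp σ (fun i => ((i : ℕ) : ℤ))] at this
    exact this
  rcases Int.units_eq_one_or (Equiv.Perm.sign σ) with h1 | h1
  · rw [h1, one_smul]; exact h
  · rw [h1, Units.neg_smul, one_smul]; exact Submodule.neg_mem _ h

lemma filt (p : Point) : ∀ (N : ℕ) (E : Submodule k K) (e : ℤ), Module.Finite k E → Module.finrank k E = N →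
    E ≤ Lv hK p e → ∃ b : Fin N → K, LinearIndependent k b ∧ (∀ j, b j ∈ E) ∧
      ∀ j : Fin N, b j ∈ Lv hK p (e + (j : ℕ)) := by
  intro N
  induction N with
  | zero =>
    intro E e _ _ _
    exact ⟨Fin.elim0, linearIndependent_empty_type, fun j => j.elim0, fun j => j.elim0⟩
  | succ N ih =>
    intro E e hfin hN hE
    haveI := hfin
    let E' := E ⊓ Lv hK p (e + 1)
    have hE'E : E' ≤ E := inf_le_left
    haveI : Module.Finite k E' := Submodule.finiteDimensional_of_le hE'E
    have hdim : N ≤ Module.finrank k E' := by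
      by_cases h : E ≤ Lv hK p (e + 1)
      · have : E' = E := inf_eq_left.2 h
        rw [this, hN]; omega
      · obtain ⟨x0, hx0E, hx0⟩ := Set.not_subset.1 h
        have hx00 : x0 ≠ 0 := by rintro rfl; exact hx0 (Submodule.zero_mem _)
        have hvx : v p x0 = e := by
          have h1 := (mem_Lv' hK hx00).1 (hE hx0E)
          have h2 : ¬ (e + 1 ≤ v p x0) := fun h => hx0 (Or.inr h)
          omega
        have hle : E ≤ E' ⊔ Submodule.span k {x0} := by
          intro x hx
          obtain ⟨c, hc⟩ := residue hK p (x / x0) (by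
            have := Lv_div hK (hE hx) hx00
            rwa [hvx, sub_self] at this)
          have h1 := Lv_mul hK hc (Lv_self hK x0)
          rw [sub_mul, div_mul_cancel₀ _ hx00, ← Algebra.smul_def, hvx] at h1
          have : x = (x - c • x0) + c • x0 := by ring
          rw [this]
          refine Submodule.add_mem_sup ⟨E.sub_mem hx (E.smul_mem c hx0E), by rwa [add_comm]⟩
            (Submodule.smul_mem _ _ (Submodule.mem_span_singleton_self x0))
        have h1 := Submodule.finrank_mono hle
        have h2 := Submodule.finrank_add_le_finrank_add_finrank E' (Submodule.span k {x0})
        rw [finrank_span_singleton hx00] at h2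
        omega
    let B := Module.finBasis k E'
    let u : Fin N → K := fun l => (B (Fin.castLE hdim l) : K)
    have hu : LinearIndependent k u :=
      (B.linearIndependent.map' E'.subtype (Submodule.ker_subtype _)).comp _ (Fin.castLE_injective hdim)
    let E'' := Submodule.span k (Set.range u)
    have hE'' : E'' ≤ E' := by
      rw [Submodule.span_le]
      rintro _ ⟨l, rfl⟩
      exact (B (Fin.castLE hdim l)).2
    haveI : Module.Finite k E'' := Submodule.finiteDimensional_of_le hE''
    have hd'' : Module.finrank k E'' = N := by
      have := finrank_span_eq_card hu
      simpa using this
    obtain ⟨b, hb1, hb2, hb3⟩ := ih E'' (e + 1) inferInstance hd'' (hE''.trans inf_le_right)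
    have hne : ¬ E ≤ E'' := by
      intro h
      have := Submodule.finrank_mono h
      omega
    obtain ⟨x, hxE, hx⟩ := Set.not_subset.1 hne
    refine ⟨Fin.cons x b, ?_, ?_, ?_⟩
    · rw [linearIndependent_finCons]
      refine ⟨hb1, fun h => hx ?_⟩
      have : Submodule.span k (Set.range b) ≤ E'' := by
        rw [Submodule.span_le]
        rintro _ ⟨l, rfl⟩
        exact hb2 l
      exact this h
    · intro j
      refine Fin.cases ?_ (fun i => ?_) j
      · simpa using hxE
      · simpa using hE'E (hE'' (hb2 i))
    · intro j
      refine Fin.cases ?_ (fun i => ?_) j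
      · simpa using hE hxE
      · have := hb3 i
        simp only [Fin.cons_succ, Fin.val_succ]
        convert this using 2
        push_cast; ring

lemma extend_family (p : Point) (E : Submodule k K) [Module.Finite k E] {ι : Type*} [Fintype ι] (u : ι → K)
    (hu : LinearIndependent k u) (huE : ∀ i, u i ∈ E) (α : ι → ℤ) (hα : ∀ i, u i ∈ Lv hK p (α i)) (η : ℤ)
    (hE : E ≤ Lv hK p η) :
    ∃ (u' : Fin (Module.finrank k E) → K) (α' : Fin (Module.finrank k E) → ℤ), LinearIndependent k u' ∧
      (∀ j, u' j ∈ E) ∧ (∀ j, u' j ∈ Lv hK p (α' j)) ∧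
      ∑ j, α' j = ∑ i, α i + ((Module.finrank k E : ℤ) - Fintype.card ι) * η := by
  let w : ι → E := fun i => ⟨u i, huE i⟩
  have hw : LinearIndependent k w := LinearIndependent.of_comp E.subtype hu
  let B := Module.Basis.sumExtend hw
  haveI : Finite (ι ⊕ (Module.Basis.sumExtendIndex hw)) := Module.Finite.finite_basis B
  haveI : Finite (Module.Basis.sumExtendIndex hw) :=
    Finite.of_injective (Sum.inr : _ → ι ⊕ (Module.Basis.sumExtendIndex hw)) Sum.inr_injective
  haveI : Fintype (Module.Basis.sumExtendIndex hw) := Fintype.ofFinite _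
  have hcard := Module.finrank_eq_card_basis B
  have hBl : ∀ i, B (Sum.inl i) = w i := by
    intro i
    simp [B, Module.Basis.sumExtend]
    rfl
  let σ : Fin (Module.finrank k E) ≃ (ι ⊕ (Module.Basis.sumExtendIndex hw)) :=
    Fintype.equivOfCardEq (by rw [← hcard]; simp)
  let α'' : (ι ⊕ (Module.Basis.sumExtendIndex hw)) → ℤ := Sum.elim α (fun _ => η)
  refine ⟨fun j => (B (σ j) : K), fun j => α'' (σ j), ?_, ?_, ?_, ?_⟩
  · exact (B.linearIndependent.map' E.subtype (Submodule.ker_subtype _)).comp _ σ.injective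
  · intro j; exact (B (σ j)).2
  · intro j
    rcases h : σ j with i | i
    · simp only [h, hBl]; exact hα i
    · simp only [h]; exact hE (B (Sum.inr i)).2
  · rw [Equiv.sum_comp σ α'', Fintype.sum_sum_type]
    simp only [α'', Sum.elim_inl, Sum.elim_inr, Finset.sum_const, Finset.card_univ]
    rw [Fintype.card_sum] at hcard
    rw [hcard]
    push_cast
    simp

lemma plucker [CharZero k] (P : Point) (E : Submodule k K) [Module.Finite k E] (S T0 : Finset Point)
    (ε β : Point → ℤ) (hε : ∀ p, p ∉ S → E ≤ Lv hK p (ε p)) (hε0 : ∀ p, p ∉ S → p ∉ T0 → ε p = 0)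
    (hβ : ∀ p ∈ S, ∃ (u : Fin (Module.finrank k E) → K) (α : Fin (Module.finrank k E) → ℤ),
      LinearIndependent k u ∧ (∀ j, u j ∈ E) ∧ (∀ j, u j ∈ Lv hK p (α j)) ∧ ∑ j, α j = β p) :
    2 * ((Module.finrank k E : ℤ) * ∑ p ∈ T0 \ S, ε p + ∑ p ∈ S, β p) ≤
      (Module.finrank k E : ℤ) * (Module.finrank k E - 1) * (2 * genus - 2 + S.card) := by
  obtain ⟨D, δ, hD, hker, hfin, hsum⟩ := good_derivation hK P
  set N := Module.finrank k E with hN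
  let B := Module.finBasis k E
  let f : Fin N → K := fun i => (B i : K)
  have hf : LinearIndependent k f := B.linearIndependent.map' E.subtype (Submodule.ker_subtype _)
  have hspan : Submodule.span k (Set.range f) = E := by
    have : Set.range f = E.subtype '' (Set.range B) := by
      rw [← Set.range_comp]; rfl
    rw [this, ← Submodule.map_span, B.span_eq, Submodule.map_top, Submodule.range_subtype]
  have hW := wr_ne_zero D hker f hf
  set W := (wrM D f).det with hWdef
  set c : ℤ := ∑ j : Fin N, (j : ℤ) with hc
  have hvW : ∀ p (u : Fin N → K) (α : Fin N → ℤ), LinearIndependent k u → (∀ j, u j ∈ E) →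
      (∀ j, u j ∈ Lv hK p (α j)) → ∑ j, α j - c * (1 + δ p) ≤ v p W := by
    intro p u α hu huE huα
    obtain ⟨a, ha0, ha⟩ := wr_change D f u hu (fun j => by rw [hspan]; exact huE j)
    have h1 := det_Lv hK D p (δ p) (hD p) u α huα
    have ha0' : algebraMap k K a ≠ 0 := (map_ne_zero _).2 ha0
    rw [ha, mem_Lv' hK (mul_ne_zero hW ha0'), hK.v_mul p _ _ hW ha0', hK.v_algebraMap p a ha0, add_zero] at h1
    exact h1
  have hout : ∀ p, p ∉ S → N * ε p - c * δ p ≤ v p W := by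
    intro p hp
    obtain ⟨b, hb1, hb2, hb3⟩ := filt hK p N E (ε p) inferInstance rfl (hε p hp)
    have := hvW p b _ hb1 hb2 hb3
    rw [Finset.sum_add_distrib] at this
    simp only [Finset.sum_const, Finset.card_univ, Fintype.card_fin, nsmul_eq_mul] at this
    rw [← hc] at this
    linarith
  have hin : ∀ p ∈ S, β p - c * (1 + δ p) ≤ v p W := by
    intro p hp
    obtain ⟨u, α, hu1, hu2, hu3, hu4⟩ := hβ p hp
    have := hvW p u α hu1 hu2 hu3
    rwa [hu4] at this
  let T := S ∪ T0 ∪ hfin.toFinset ∪ (hK.finite_support W hW).toFinset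
  have h0 := sum_of_subset hK W hW T (fun p hp => by simp [T, hp])
  have hδ := hsum T (fun p hp => by simp [T, hp])
  have hST : S ⊆ T := by intro p hp; simp [T, hp]
  rw [← Finset.sum_sdiff hST] at h0 hδ
  have h1 : ∑ p ∈ T \ S, (N * ε p - c * δ p) ≤ ∑ p ∈ T \ S, v p W :=
    Finset.sum_le_sum fun p hp => hout p (Finset.mem_sdiff.1 hp).2
  have h2 : ∑ p ∈ S, (β p - c * (1 + δ p)) ≤ ∑ p ∈ S, v p W := Finset.sum_le_sum hin
  have h3 : ∑ p ∈ T \ S, ε p = ∑ p ∈ T0 \ S, ε p := by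
    symm
    apply Finset.sum_subset
    · apply Finset.sdiff_subset_sdiff _ (le_refl S)
      intro p hp; simp [T, hp]
    · intro p hp hp'
      rw [Finset.mem_sdiff] at hp hp'
      exact hε0 p hp.2 (fun h => hp' ⟨h, hp.2⟩)
  rw [Finset.sum_sub_distrib, ← Finset.mul_sum, ← Finset.mul_sum, h3] at h1
  rw [Finset.sum_sub_distrib, ← Finset.mul_sum, Finset.sum_add_distrib] at h2
  simp only [Finset.sum_const, nsmul_eq_mul, mul_one] at h2
  have hc2 : 2 * c = N * (N - 1) := by
    have := Finset.sum_range_id_mul_two N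
    rw [hc, Fin.sum_univ_eq_sum_range (fun i => (i : ℤ))]
    rcases N.eq_zero_or_pos with h | h
    · simp [h]
    zify [h] at this
    linarith
  have hc0 : 0 ≤ c := Finset.sum_nonneg fun j _ => by positivity
  rw [← hc2]
  nlinarith [mul_le_mul_of_nonneg_left hδ hc0]
end Plucker
end Part7
end FunctionFieldGCD

namespace FunctionFieldGCD
section Part8
section Poly
open MvPolynomial
variable {K : Type*} [Field K] {n : ℕ}

/-- exponents of total degree at most `m` -/
noncomputable def expo (n m : ℕ) : Finset (Fin n →₀ ℕ) :=
  (Finset.range (m + 1)).biUnion fun s => Finset.finsuppAntidiag Finset.univ s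

lemma mem_expo {m : ℕ} {l : Fin n →₀ ℕ} : l ∈ expo n m ↔ ∑ i, l i ≤ m := by
  simp [expo, Finset.mem_finsuppAntidiag]

lemma card_expo (m : ℕ) : (expo n m).card = (m + n).choose n := by
  rw [expo, Finset.card_biUnion]
  · simp only [Finset.card_finsuppAntidiag_nat_eq_multichoose, Finset.card_univ, Fintype.card_fin]
    exact Nat.sum_range_multichoose m n
  · intro s _ t _ hst
    rw [Function.onFun, Finset.disjoint_left]
    intro l hl hl'
    simp [Finset.mem_finsuppAntidiag] at hl hl'
    omega

lemma finrank_R (m : ℕ) : Module.finrank K (restrictTotalDegree (Fin n) K m) = (m + n).choose n := by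
  have h : restrictTotalDegree (Fin n) K m = restrictSupport K (expo n m : Set (Fin n →₀ ℕ)) := by
    unfold restrictTotalDegree
    congr 1
    ext l
    simp [mem_expo, Finsupp.sum_fintype]
  rw [h, Module.finrank_eq_card_basis (basisRestrictSupport K (expo n m : Set (Fin n →₀ ℕ)))]
  simp [card_expo]

/-- multiples of `F` by polynomials of degree at most `a` -/
noncomputable def mulSub (F : MvPolynomial (Fin n) K) (a : ℕ) : Submodule K (MvPolynomial (Fin n) K) :=
  (restrictTotalDegree (Fin n) K a).map (LinearMap.mulLeft K F)

lemma mem_mulSub {F : MvPolynomial (Fin n) K} {a : ℕ} {p : MvPolynomial (Fin n) K} :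
    p ∈ mulSub F a ↔ ∃ q, q.totalDegree ≤ a ∧ F * q = p := by
  simp [mulSub, mem_restrictTotalDegree]

instance (F : MvPolynomial (Fin n) K) (a : ℕ) : Module.Finite K (mulSub F a) := by
  unfold mulSub; infer_instance

lemma finrank_mulSub (F : MvPolynomial (Fin n) K) (hF : F ≠ 0) (a : ℕ) :
    Module.finrank K (mulSub F a) = (a + n).choose n := by
  rw [← finrank_R (K := K)]
  exact (Submodule.equivMapOfInjective _ (mul_right_injective₀ hF) _).finrank_eq.symm

lemma mulSub_span (F : MvPolynomial (Fin n) K) (a : ℕ) :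
    mulSub F a = Submodule.span K ((fun i => F * monomial i 1) '' (expo n a : Set (Fin n →₀ ℕ))) := by
  have h : restrictTotalDegree (Fin n) K a = restrictSupport K (expo n a : Set (Fin n →₀ ℕ)) := by
    unfold restrictTotalDegree
    congr 1
    ext l
    simp [mem_expo, Finsupp.sum_fintype]
  rw [mulSub, h, restrictSupport_eq_span, Submodule.map_span, Set.image_image]
  rfl

lemma finrank_sup (d m : ℕ) (hm : 2 * d ≤ m) (F1 F2 : MvPolynomial (Fin n) K) (hcop : CoprimePoly F1 F2)
    (h1 : F1 ≠ 0) (h2 : F2 ≠ 0) (hd1 : F1.totalDegree = d) (hd2 : F2.totalDegree = d) :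
    Module.finrank K (mulSub F1 (m - d) ⊔ mulSub F2 (m - d) : Submodule K _) = Mconst n d m := by
  have hinf : mulSub F1 (m - d) ⊓ mulSub F2 (m - d) = mulSub (F1 * F2) (m - 2 * d) := by
    ext p
    rw [Submodule.mem_inf, mem_mulSub, mem_mulSub, mem_mulSub]
    constructor
    · rintro ⟨⟨q, hq, rfl⟩, ⟨q', hq', h⟩⟩
      have hrel : IsRelPrime F2 F1 := fun x hx hx' => hcop x hx' hx
      obtain ⟨r, rfl⟩ : F2 ∣ q := hrel.dvd_of_dvd_mul_left ⟨q', h.symm⟩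
      refine ⟨r, ?_, by ring⟩
      by_cases hr : r = 0
      · simp [hr]
      rw [totalDegree_mul_of_isDomain h2 hr] at hq
      omega
    · rintro ⟨r, hr, rfl⟩
      refine ⟨⟨F2 * r, ?_, by ring⟩, ⟨F1 * r, ?_, by ring⟩⟩
      · have := totalDegree_mul F2 r; omega
      · have := totalDegree_mul F1 r; omega
  have h := Submodule.finrank_sup_add_finrank_inf_eq (mulSub F1 (m - d)) (mulSub F2 (m - d))
  rw [hinf, finrank_mulSub _ h1, finrank_mulSub _ h2, finrank_mulSub _ (mul_ne_zero h1 h2)] at h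
  have e1 : m + n - d = m - d + n := by omega
  have e2 : m + n - 2 * d = m - 2 * d + n := by omega
  rw [Mconst, e1, e2]
  omega

lemma Mconst_le (d m : ℕ) (hm : 2 * d ≤ m) (F1 F2 : MvPolynomial (Fin n) K) (hcop : CoprimePoly F1 F2)
    (h1 : F1 ≠ 0) (h2 : F2 ≠ 0) (hd1 : F1.totalDegree = d) (hd2 : F2.totalDegree = d) :
    Mconst n d m ≤ (m + n).choose n := by
  rw [← finrank_sup d m hm F1 F2 hcop h1 h2 hd1 hd2, ← finrank_R (K := K)]
  apply Submodule.finrank_mono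
  rw [sup_le_iff]
  constructor
  · intro p hp
    obtain ⟨q, hq, rfl⟩ := mem_mulSub.1 hp
    rw [mem_restrictTotalDegree]
    have := totalDegree_mul F1 q
    omega
  · intro p hp
    obtain ⟨q, hq, rfl⟩ := mem_mulSub.1 hp
    rw [mem_restrictTotalDegree]
    have := totalDegree_mul F2 q
    omega

lemma poly_family (d m : ℕ) (hm : 2 * d ≤ m) (F1 F2 : MvPolynomial (Fin n) K) (hcop : CoprimePoly F1 F2)
    (h1 : F1 ≠ 0) (h2 : F2 ≠ 0) (hd1 : F1.totalDegree = d) (hd2 : F2.totalDegree = d) :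
    ∃ φ : Fin (Mconst n d m) → MvPolynomial (Fin n) K, LinearIndependent K φ ∧
      ∀ b, ∃ i : Fin n →₀ ℕ, ∑ j, i j ≤ m - d ∧ (φ b = F1 * monomial i 1 ∨ φ b = F2 * monomial i 1) := by
  set s : Set (MvPolynomial (Fin n) K) :=
    ((fun i => F1 * monomial i 1) '' (expo n (m - d) : Set (Fin n →₀ ℕ))) ∪
    ((fun i => F2 * monomial i 1) '' (expo n (m - d) : Set (Fin n →₀ ℕ))) with hs
  have hspan : Submodule.span K s = mulSub F1 (m - d) ⊔ mulSub F2 (m - d) := by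
    rw [hs, Submodule.span_union, mulSub_span, mulSub_span]
  obtain ⟨b, hbs, hb, hli⟩ := exists_linearIndependent K s
  have hfin : s.Finite := ((Finset.finite_toSet _).image _).union ((Finset.finite_toSet _).image _)
  haveI : Fintype b := (hfin.subset hbs).fintype
  have hcard : Fintype.card b = Mconst n d m := by
    rw [← finrank_sup d m hm F1 F2 hcop h1 h2 hd1 hd2, ← hspan, ← hb]
    have := finrank_span_eq_card hli
    rw [Subtype.range_coe] at this
    exact this.symm
  let σ : Fin (Mconst n d m) ≃ b := (Fintype.equivFinOfCardEq hcard).symm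
  refine ⟨fun j => (σ j : MvPolynomial (Fin n) K), hli.comp _ σ.injective, fun j => ?_⟩
  rcases hbs (σ j).2 with ⟨i, hi, h⟩ | ⟨i, hi, h⟩
  · exact ⟨i, mem_expo.1 hi, Or.inl h.symm⟩
  · exact ⟨i, mem_expo.1 hi, Or.inr h.symm⟩

lemma Mprime_formula (d m : ℕ) (hm : 2 * d ≤ m) (h : Mconst n d m ≤ (m + n).choose n) :
    (Mprime n d m : ℤ) = (Nat.choose (m + n) n : ℤ)
        - 2 * (Nat.choose (m + n - d) n : ℤ) + (Nat.choose (m + n - 2 * d) n : ℤ) := by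
  have h2 : (m + n - 2 * d).choose n ≤ (m + n - d).choose n := Nat.choose_le_choose _ (by omega)
  unfold Mprime
  rw [Nat.cast_sub h]
  unfold Mconst
  rw [Nat.cast_sub (by omega)]
  push_cast
  ring

lemma choose_tel (x q a : ℕ) : (x + a).choose (q + 1) = x.choose (q + 1) + ∑ j ∈ Finset.range a, (x + j).choose q := by
  induction a with
  | zero => simp
  | succ a ih =>
    rw [Finset.sum_range_succ, ← add_assoc, Nat.choose_succ_succ, ih]; ring

lemma Mprime_bound (d : ℕ) (hd : 0 < d) (h : ∀ m, 2 * d ≤ m → Mconst n d m ≤ (m + n).choose n) :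
    ∃ C : ℝ, ∀ m : ℕ, 2 * d ≤ m → (Mprime n d m : ℝ) ≤ C * (m : ℝ) ^ (n - 2) := by
  rcases n with _ | _ | q
  · refine ⟨0, fun m hm => ?_⟩
    have := Mprime_formula d m hm (h m hm)
    simp at this
    simp [this]
  · refine ⟨0, fun m hm => ?_⟩
    have := Mprime_formula d m hm (h m hm)
    simp at this
    have h0 : (Mprime 1 d m : ℤ) = 0 := by omega
    have h0' : Mprime 1 d m = 0 := by exact_mod_cast h0
    simp [h0']
  · refine ⟨((d * (d * (q + 3) ^ q) : ℕ) : ℝ), fun m hm => ?_⟩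
    have hf := Mprime_formula d m hm (h m hm)
    obtain ⟨y, rfl⟩ : ∃ y, m = y + 2 * d := ⟨m - 2 * d, by omega⟩
    set z := y + (q + 2) with hz
    have e1 : y + 2 * d + (q + 1 + 1) = z + d + d := by omega
    have e2 : z + d + d - d = z + d := by omega
    have e3 : z + d + d - 2 * d = z := by omega
    rw [e1, e2, e3, choose_tel (z + d), choose_tel z] at hf
    have h4 : ∑ j ∈ Finset.range d, (z + d + j).choose (q + 1) ≤
        ∑ j ∈ Finset.range d, ((z + j).choose (q + 1) + d * (z + d + d).choose q) := by
      apply Finset.sum_le_sum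
      intro j hj
      rw [Finset.mem_range] at hj
      have e : z + d + j = z + j + d := by ring
      rw [e, choose_tel (z + j)]
      gcongr
      calc ∑ i ∈ Finset.range d, (z + j + i).choose q ≤ ∑ i ∈ Finset.range d, (z + d + d).choose q := by
            apply Finset.sum_le_sum
            intro i hi
            rw [Finset.mem_range] at hi
            exact Nat.choose_le_choose _ (by omega)
        _ = _ := by simp
    rw [Finset.sum_add_distrib] at h4
    simp only [Finset.sum_const, Finset.card_range, smul_eq_mul] at h4
    have h5 : (z + d + d).choose q ≤ (q + 3) ^ q * (y + 2 * d) ^ q := by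
      rw [← mul_pow]
      have h6 : (z + d + d).choose q ≤ (z + d + d) ^ q := Nat.choose_le_pow _ _
      refine h6.trans (Nat.pow_le_pow_left ?_ q)
      nlinarith
    have h7 : Mprime (q + 1 + 1) d (y + 2 * d) ≤ d * (d * (z + d + d).choose q) := by
      push_cast at hf
      zify at h4 ⊢
      linarith
    have h8 : Mprime (q + 1 + 1) d (y + 2 * d) ≤ (d * (d * (q + 3) ^ q)) * (y + 2 * d) ^ q := by
      calc _ ≤ _ := h7
        _ ≤ d * (d * ((q + 3) ^ q * (y + 2 * d) ^ q)) := by gcongr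
        _ = _ := by ring
    exact_mod_cast h8
end Poly
end Part8
end FunctionFieldGCD

namespace FunctionFieldGCD
section Part9
section Mat
variable {K : Type*} [Field K]

lemma exists_minor {M : ℕ} {ι : Type*} [Fintype ι] (A : Matrix (Fin M) ι K) (hA : LinearIndependent K A.row) :
    ∃ J : Fin M → ι, (A.submatrix id J).det ≠ 0 := by
  have h1 : A.rank = M := by simpa using hA.rank_matrix
  rw [Matrix.rank_eq_finrank_span_cols] at h1
  obtain ⟨b, hbs, hb, hli⟩ := exists_linearIndependent K (Set.range A.col)
  haveI : Fintype b := ((Set.finite_range A.col).subset hbs).fintype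
  have hcard : Fintype.card b = M := by
    have := finrank_span_eq_card hli
    rw [Subtype.range_coe, hb, h1] at this
    exact this.symm
  let σ : Fin M ≃ b := (Fintype.equivFinOfCardEq hcard).symm
  choose J hJ using fun a => hbs (σ a).2
  refine ⟨J, ?_⟩
  rw [← isUnit_iff_ne_zero, ← Matrix.isUnit_iff_isUnit_det, ← Matrix.linearIndependent_cols_iff_isUnit]
  have : (A.submatrix id J).col = fun a => ((σ a : b) : Fin M → K) := by
    funext a
    rw [← hJ a]; rfl
  rw [this]
  exact hli.comp _ σ.injective

lemma exists_min_minor {M : ℕ} {ι : Type*} [Fintype ι] (A : Matrix (Fin M) ι K) (hA : LinearIndependent K A.row)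
    (w : ι → ℤ) :
    ∃ J : Fin M → ι, (A.submatrix id J).det ≠ 0 ∧
      ∀ a l, (A.submatrix id (Function.update J a l)).det ≠ 0 → w (J a) ≤ w l := by
  obtain ⟨J0, hJ0⟩ := exists_minor A hA
  obtain ⟨J, hJ, hmin⟩ := (Finset.univ.filter fun J : Fin M → ι => (A.submatrix id J).det ≠ 0).exists_min_image
    (fun J => ∑ a, w (J a)) ⟨J0, by simp [hJ0]⟩
  refine ⟨J, by simpa using hJ, fun a l h => ?_⟩
  have := hmin (Function.update J a l) (by simpa using h)
  have e : ∀ J' : Fin M → ι, ∑ x, w (J' x) = w (J' a) + ∑ x ∈ Finset.univ.erase a, w (J' x) := fun J' =>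
    (Finset.add_sum_erase _ _ (Finset.mem_univ a)).symm
  rw [e J, e (Function.update J a l)] at this
  have e2 : ∑ x ∈ Finset.univ.erase a, w (Function.update J a l x) = ∑ x ∈ Finset.univ.erase a, w (J x) :=
    Finset.sum_congr rfl fun x hx => by rw [Function.update_of_ne (Finset.ne_of_mem_erase hx)]
  rw [e2, Function.update_self] at this
  omega

lemma adj_coeff {M : ℕ} {ι : Type*} (A : Matrix (Fin M) ι K) (J : Fin M → ι) (a : Fin M) (l : ι) :
    ∑ b, (A.submatrix id J).adjugate a b * A b l = (A.submatrix id (Function.update J a l)).det := by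
  have h : (A.submatrix id (Function.update J a l)) = (A.submatrix id J).updateCol a (A.col l) := by
    ext i j
    by_cases hj : j = a
    · subst hj; simp [Matrix.updateCol_self]
    · simp [Matrix.updateCol_ne hj, hj]
  rw [h, ← Matrix.cramer_apply, Matrix.cramer_eq_adjugate_mulVec]
  rfl

variable {k : Type*} [Field k] [Algebra k K] (V : Submodule k K) (h1V : (1 : K) ∈ V)

lemma prod_mem_pow {ι : Type*} (s : Finset ι) (f : ι → K) (h : ∀ i ∈ s, f i ∈ V) : ∏ i ∈ s, f i ∈ V ^ s.card := by
  induction s using Finset.induction_on with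
  | empty => simp
  | insert i s hi ih =>
    rw [Finset.prod_insert hi, Finset.card_insert_of_notMem hi, pow_succ']
    exact Submodule.mul_mem_mul (h i (Finset.mem_insert_self _ _)) (ih fun j hj => h j (Finset.mem_insert_of_mem hj))

lemma det_mem_pow {M : ℕ} (B : Matrix (Fin M) (Fin M) K) (h : ∀ i j, B i j ∈ V) : B.det ∈ V ^ M := by
  rw [Matrix.det_apply]
  apply Submodule.sum_mem
  intro σ _
  have h : ∏ i, B (σ i) i ∈ V ^ M := by
    have := prod_mem_pow V Finset.univ (fun i => B (σ i) i) (fun i _ => h _ _)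
    simpa using this
  rcases Int.units_eq_one_or (Equiv.Perm.sign σ) with h1 | h1
  · rw [h1, one_smul]; exact h
  · rw [h1, Units.neg_smul, one_smul]; exact Submodule.neg_mem _ h

include h1V in
lemma adj_mem_pow {M : ℕ} (B : Matrix (Fin M) (Fin M) K) (h : ∀ i j, B i j ∈ V) (a b : Fin M) :
    B.adjugate a b ∈ V ^ M := by
  rw [Matrix.adjugate_apply]
  apply det_mem_pow
  intro i j
  by_cases hi : i = b
  · subst hi
    rw [Matrix.updateRow_self, Pi.single_apply]
    split_ifs
    · exact h1V
    · exact V.zero_mem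
  · rw [Matrix.updateRow_ne hi]; exact h i j

include h1V in
lemma pow_le_pow_V {a b : ℕ} (h : a ≤ b) : V ^ a ≤ V ^ b :=
  pow_le_pow_right' (Submodule.one_le.2 h1V) h

variable {Point : Type*} {v : Point → K → ℤ} {genus : ℕ} (hK : IsFunctionField k v genus)

lemma pow_le_Lv (p : Point) (ω : ℤ) (hV : V ≤ Lv hK p (-ω)) (a : ℕ) : V ^ a ≤ Lv hK p (-(a * ω)) := by
  induction a with
  | zero =>
    rw [pow_zero, Submodule.one_le]
    simpa using Lv_one hK
  | succ a ih =>
    rw [pow_succ, Submodule.mul_le]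
    intro x hx y hy
    have := Lv_mul hK (ih hx) (hV hy)
    convert this using 2
    push_cast; ring

end Mat

section Loc
open MvPolynomial
variable {k K Point : Type*} [Field k] [Field K] [Algebra k K] (V : Submodule k K)
  {n M m : ℕ} (φ : Fin M → MvPolynomial (Fin n) K) (g : Fin n → K) (q : ℕ)

noncomputable def Theta : (Fin M → ↥(V ^ q)) →ₗ[k] K where
  toFun c := ∑ b, (c b : K) * eval g (φ b)
  map_add' c c' := by simp [add_mul, Finset.sum_add_distrib]
  map_smul' a c := by simp [Finset.smul_sum]

lemma Theta_apply (c : Fin M → ↥(V ^ q)) : Theta V φ g q c = ∑ b, (c b : K) * eval g (φ b) := rfl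

lemma Theta_inj (hφ : LinearIndependent K φ) (hφV : ∀ b l, coeff l (φ b) ∈ V)
    (hφd : ∀ b, (φ b).totalDegree ≤ m)
    (hnd : ∀ Q : MvPolynomial (Fin n) K, (∀ l, coeff l Q ∈ V ^ (q + 1)) → Q.totalDegree ≤ m →
      eval g Q = 0 → Q = 0) : Function.Injective (Theta V φ g q) := by
  rw [injective_iff_map_eq_zero]
  intro c hc
  have h0 := hnd (∑ b, (c b : K) • φ b) (by
    intro l
    rw [coeff_sum]
    apply Submodule.sum_mem
    intro b _
    rw [coeff_smul, smul_eq_mul, pow_succ]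
    exact Submodule.mul_mem_mul (c b).2 (hφV b l)) (by
    refine (totalDegree_finset_sum _ _).trans (Finset.sup_le fun b _ => ?_)
    exact (totalDegree_smul_le _ _).trans (hφd b)) (by
    rw [← hc, Theta_apply]
    simp [smul_eval])
  have := Fintype.linearIndependent_iff.1 hφ _ h0
  funext b
  exact Subtype.ext (this b)

lemma eval_expo (Q : MvPolynomial (Fin n) K) (hQ : Q.totalDegree ≤ m) :
    eval g Q = ∑ l : expo n m, coeff (l : Fin n →₀ ℕ) Q * ∏ i, g i ^ (l : Fin n →₀ ℕ) i := by
  rw [eval_eq', Finset.sum_coe_sort (expo n m) (fun l => coeff l Q * ∏ i, g i ^ l i)]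
  apply Finset.sum_subset
  · intro l hl
    rw [mem_expo]
    have := le_totalDegree hl
    rw [Finsupp.sum_fintype _ _ (fun _ => rfl)] at this
    omega
  · intro l _ hl
    rw [notMem_support_iff.1 hl, zero_mul]

variable {v : Point → K → ℤ} {genus : ℕ} (hK : IsFunctionField k v genus)

/-- order of `g^l` at `p` -/
def wt (v : Point → K → ℤ) (g : Fin n → K) (p : Point) (l : Fin n →₀ ℕ) : ℤ := ∑ i, (l i : ℤ) * v p (g i)

lemma gl_Lv (hg : ∀ i, g i ≠ 0) (p : Point) (l : Fin n →₀ ℕ) :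
    ∏ i, g i ^ l i ∈ Lv hK p (wt v g p l) := by
  refine Or.inr (le_of_eq ?_)
  rw [v_prod hK p _ _ (fun i _ => pow_ne_zero _ (hg i))]
  exact Finset.sum_congr rfl fun i _ => (v_pow hK p _ (hg i) _).symm

lemma wt_lower (p : Point) (l : Fin n →₀ ℕ) (hl : ∑ i, l i ≤ m) : m * ∑ i, min 0 (v p (g i)) ≤ wt v g p l := by
  rw [Finset.mul_sum, wt]
  apply Finset.sum_le_sum
  intro i _
  have : l i ≤ m := (Finset.single_le_sum (f := fun i => l i) (fun _ _ => Nat.zero_le _) (Finset.mem_univ i)).trans hl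
  have h2 : (l i : ℤ) ≤ m := by exact_mod_cast this
  have h3 : min 0 (v p (g i)) ≤ 0 := min_le_left _ _
  have h4 : min 0 (v p (g i)) ≤ v p (g i) := min_le_right _ _
  have h5 : (0 : ℤ) ≤ l i := by positivity
  nlinarith

lemma wt_upper (p : Point) (l : Fin n →₀ ℕ) (hl : ∑ i, l i ≤ m) : wt v g p l ≤ m * ∑ i, max 0 (v p (g i)) := by
  rw [Finset.mul_sum, wt]
  apply Finset.sum_le_sum
  intro i _
  have : l i ≤ m := (Finset.single_le_sum (f := fun i => l i) (fun _ _ => Nat.zero_le _) (Finset.mem_univ i)).trans hl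
  have h2 : (l i : ℤ) ≤ m := by exact_mod_cast this
  have h3 : 0 ≤ max 0 (v p (g i)) := le_max_left _ _
  have h4 : v p (g i) ≤ max 0 (v p (g i)) := le_max_right _ _
  have h5 : (0 : ℤ) ≤ l i := by positivity
  nlinarith

lemma range_lower (hg : ∀ i, g i ≠ 0) (hφV : ∀ b l, coeff l (φ b) ∈ V)
    (hφd : ∀ b, (φ b).totalDegree ≤ m) (p : Point) (ω : ℤ) (hV : V ≤ Lv hK p (-ω)) :
    LinearMap.range (Theta V φ g q) ≤ Lv hK p (m * ∑ i, min 0 (v p (g i)) - (q + 1) * ω) := by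
  have hw := fun (l : Fin n →₀ ℕ) hl => wt_lower (v := v) (m := m) g p l hl
  generalize (m : ℤ) * ∑ i, min 0 (v p (g i)) = B at hw ⊢
  rintro _ ⟨c, rfl⟩
  rw [Theta_apply]
  apply Submodule.sum_mem
  intro b _
  rw [eval_expo g (φ b) (hφd b), Finset.mul_sum]
  apply Submodule.sum_mem
  intro l _
  refine Lv_mono hK ?_ (Lv_mul hK (pow_le_Lv V hK p ω hV q (c b).2)
    (Lv_mul hK (hV (hφV b l)) (gl_Lv g hK hg p l)))
  have := hw (l : Fin n →₀ ℕ) (mem_expo.1 l.2)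
  linarith

lemma local_S (hg : ∀ i, g i ≠ 0) (h1V : (1 : K) ∈ V) [Module.Finite k V] (hφ : LinearIndependent K φ)
    (hφV : ∀ b l, coeff l (φ b) ∈ V) (hφd : ∀ b, (φ b).totalDegree ≤ m)
    (r : ℕ) (hinj : Function.Injective (Theta V φ g (M * (r + 1))))
    (p : Point) (ω : ℤ) (hV : V ≤ Lv hK p (-ω)) :
    ∃ (J : Fin M → expo n m), Function.Injective J ∧
      ∃ u : Fin M × Fin (Module.finrank k ↥(V ^ (M * r))) → K, LinearIndependent k u ∧
        (∀ i, u i ∈ LinearMap.range (Theta V φ g (M * (r + 1)))) ∧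
        ∀ i, u i ∈ Lv hK p (wt v g p (J i.1) - M * (r + 1) * ω) := by
  let A : Matrix (Fin M) (expo n m) K := Matrix.of fun b l => coeff (l : Fin n →₀ ℕ) (φ b)
  have hA : LinearIndependent K A.row := by
    rw [Fintype.linearIndependent_iff]
    intro c hc
    apply Fintype.linearIndependent_iff.1 hφ c
    ext l
    rw [coeff_sum, coeff_zero]
    by_cases hl : l ∈ expo n m
    · have := congrFun hc ⟨l, hl⟩
      simpa [A] using this
    · apply Finset.sum_eq_zero
      intro b _
      rw [coeff_smul]
      have : coeff l (φ b) = 0 := by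
        by_contra h
        apply hl
        rw [mem_expo]
        have h2 := le_totalDegree (mem_support_iff.2 h)
        rw [Finsupp.sum_fintype _ _ (fun _ => rfl)] at h2
        have := hφd b
        omega
      rw [this, smul_zero]
  obtain ⟨J, hJ, hmin⟩ := exists_min_minor A hA (fun l => wt v g p l)
  have hAV : ∀ (J' : Fin M → expo n m) i j, (A.submatrix id J') i j ∈ V := fun J' i j => hφV _ _
  have hJinj : Function.Injective J := by
    intro a b hab
    by_contra hne
    apply hJ
    apply Matrix.det_zero_of_column_eq hne
    intro i
    simp [hab]
  refine ⟨J, hJinj, ?_⟩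
  set Bm := A.submatrix id J with hBm
  haveI : Module.Finite k ↥(V ^ (M * r)) := Module.Finite.iff_fg.2 ((Module.Finite.iff_fg.1 ‹Module.Finite k V›).pow _)
  let β := Module.finBasis k ↥(V ^ (M * r))
  have hmem : ∀ a b (y : K), y ∈ V ^ (M * r) → Bm.adjugate a b * y ∈ V ^ (M * (r + 1)) := by
    intro a b y hy
    have := Submodule.mul_mem_mul (adj_mem_pow V h1V Bm (hAV J) a b) hy
    rwa [← pow_add, show M + M * r = M * (r + 1) by ring] at this
  let U : Fin M × Fin (Module.finrank k ↥(V ^ (M * r))) → (Fin M → ↥(V ^ (M * (r + 1)))) :=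
    fun i b => ⟨Bm.adjugate i.1 b * (β i.2 : K), hmem _ _ _ (β i.2).2⟩
  have hU : LinearIndependent k U := by
    rw [Fintype.linearIndependent_iff]
    intro x hx
    let y : Fin M → K := fun a => ∑ s, x (a, s) • (β s : K)
    have hy : Matrix.vecMul y Bm.adjugate = 0 := by
      funext b
      have h1 := congrArg (Subtype.val) (congrFun hx b)
      simp only [Finset.sum_apply, Pi.smul_apply, AddSubmonoidClass.coe_finset_sum, Submodule.coe_smul, U,
        Pi.zero_apply, Submodule.coe_zero] at h1
      rw [Pi.zero_apply, ← h1, Fintype.sum_prod_type]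
      simp only [Matrix.vecMul, dotProduct, y, Finset.sum_mul]
      refine Finset.sum_congr rfl fun a _ => Finset.sum_congr rfl fun s _ => ?_
      rw [Algebra.smul_def, Algebra.smul_def]; ring
    have hy0 : y = 0 := by
      apply Matrix.eq_zero_of_vecMul_eq_zero (M := Bm.adjugate) _ hy
      rw [Matrix.det_adjugate]
      exact pow_ne_zero _ hJ
    rintro ⟨a, s⟩
    have h2 : ∑ s, x (a, s) • β s = 0 := by
      apply Subtype.ext
      have := congrFun hy0 a
      simpa [y] using this
    exact Fintype.linearIndependent_iff.1 β.linearIndependent _ h2 s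
  refine ⟨fun i => Theta V φ g (M * (r + 1)) (U i), hU.map' _ (LinearMap.ker_eq_bot.2 hinj),
    fun i => ⟨_, rfl⟩, ?_⟩
  rintro ⟨a, s⟩
  have hval : Theta V φ g (M * (r + 1)) (U (a, s)) =
      ∑ l : expo n m, (β s : K) * ((A.submatrix id (Function.update J a l)).det * ∏ i, g i ^ (l : Fin n →₀ ℕ) i) := by
    rw [Theta_apply]
    simp only [← adj_coeff, U]
    have : ∀ b, eval g (φ b) = ∑ l : expo n m, A b l * ∏ i, g i ^ (l : Fin n →₀ ℕ) i := fun b =>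
      eval_expo g (φ b) (hφd b)
    simp only [this, Finset.mul_sum, Finset.sum_mul]
    rw [Finset.sum_comm]
    refine Finset.sum_congr rfl fun a _ => Finset.sum_congr rfl fun s _ => ?_
    ring
  simp only
  rw [hval]
  apply Submodule.sum_mem
  intro l _
  by_cases hdet : (A.submatrix id (Function.update J a l)).det = 0
  · rw [hdet]; simp
  have hw := hmin a l hdet
  have h1 := pow_le_Lv V hK p ω hV _ (β s).2
  have h2 := pow_le_Lv V hK p ω hV _ (det_mem_pow V _ (hAV (Function.update J a l)))
  refine Lv_mono hK ?_ (Lv_mul hK h1 (Lv_mul hK h2 (gl_Lv g hK hg p l)))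
  push_cast
  linarith

end Loc
end Part9
end FunctionFieldGCD

namespace FunctionFieldGCD
section Part10
section Core
open MvPolynomial
variable {k K Point : Type*} [Field k] [Field K] [Algebra k K] {v : Point → K → ℤ} {genus : ℕ}
  (hK : IsFunctionField k v genus)

lemma sum_wt {n m : ℕ} (g : Fin n → K) (hg : ∀ i, g i ≠ 0) (S : Finset Point) (hgS : ∀ p, p ∉ S → ∀ i, v p (g i) = 0)
    (hK : IsFunctionField k v genus) : ∑ p ∈ S, ∑ l : expo n m, wt v g p l = 0 := by
  rw [Finset.sum_comm]
  apply Finset.sum_eq_zero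
  intro l _
  unfold wt
  rw [Finset.sum_comm]
  apply Finset.sum_eq_zero
  intro i _
  rw [← Finset.mul_sum, sum_of_subset hK (g i) (hg i) S, mul_zero]
  intro p hp
  by_contra h
  exact hp (hgS p h i)

lemma wt_J {n m M : ℕ} (g : Fin n → K) (p : Point) (J : Fin M → expo n m) (hJ : Function.Injective J) :
    ∑ l : expo n m, wt v g p l ≤ ∑ a, wt v g p (J a) + (((expo n m).card : ℤ) - M) * (m * ∑ i, max 0 (v p (g i))) := by
  have e1 : ∑ a, wt v g p (J a) = ∑ l ∈ Finset.univ.image J, wt v g p l := by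
    rw [Finset.sum_image (fun a _ b _ h => hJ h)]
  have e2 := Finset.sum_add_sum_compl (Finset.univ.image J) (fun l : expo n m => wt v g p l)
  rw [← e2, ← e1]
  have hc : ((Finset.univ.image J)ᶜ.card : ℤ) = ((expo n m).card : ℤ) - M := by
    have := Finset.card_add_card_compl (Finset.univ.image J)
    rw [Finset.card_image_of_injective _ hJ] at this
    simp only [Finset.card_univ, Fintype.card_fin, Fintype.card_coe] at this
    omega
  have := Finset.sum_le_card_nsmul (Finset.univ.image J)ᶜ (fun l : expo n m => wt v g p l) _
    (fun l _ => wt_upper g p l (mem_expo.1 l.2))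
  rw [nsmul_eq_mul, hc] at this
  linarith

lemma core [CharZero k] (P : Point) (V : Submodule k K) [Module.Finite k V] (h1V : (1 : K) ∈ V)
    {n M m : ℕ} (φ : Fin M → MvPolynomial (Fin n) K) (g : Fin n → K) (r : ℕ)
    (hφ : LinearIndependent K φ) (hφV : ∀ b l, coeff l (φ b) ∈ V)
    (hφd : ∀ b, (φ b).totalDegree ≤ m) (hinj : Function.Injective (Theta V φ g (M * (r + 1))))
    (hg : ∀ i, g i ≠ 0) (S T0 : Finset Point) (hST : S ⊆ T0) (hgS : ∀ p, p ∉ S → ∀ i, v p (g i) = 0)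
    (ω G : Point → ℤ) (hω : ∀ p, 0 ≤ ω p) (hV : ∀ p, V ≤ Lv hK p (-ω p))
    (hG : ∀ p, p ∉ S → ∀ b, eval g (φ b) ∈ Lv hK p (G p - ω p))
    (h0 : ∀ p, p ∉ T0 → G p = 0 ∧ ω p = 0) (H : ℤ) (hH : ∀ i, ∑ p ∈ S, max 0 (v p (g i)) ≤ H)
    (hMe : M ≤ (expo n m).card) (D D' : ℤ) (hD : D = Module.finrank k ↥(V ^ (M * (r + 1))))
    (hD' : D' = Module.finrank k ↥(V ^ (M * r))) :
    2 * ((M * D) * ∑ p ∈ T0 \ S, G p) ≤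
      2 * (D' * ((expo n m).card - M) * (m * (n * H)) + (M * D - M * D') * (m * (n * H))
        + M * D * (M * (r + 1) + 1) * ∑ p ∈ T0, ω p)
      + (M * D) * (M * D - 1) * (2 * genus - 2 + S.card) := by
  set E := LinearMap.range (Theta V φ g (M * (r + 1))) with hE
  haveI hfin : ∀ a : ℕ, Module.Finite k ↥(V ^ a) := fun a =>
    Module.Finite.iff_fg.2 ((Module.Finite.iff_fg.1 inferInstance).pow a)
  haveI : Module.Finite k E := Module.Finite.range _
  have hN : (Module.finrank k E : ℤ) = M * D := by
    rw [hE, LinearMap.finrank_range_of_inj hinj, hD]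
    rw [Module.finrank_pi_fintype]
    simp
  have hD0 : 0 ≤ D' := by rw [hD']; positivity
  have hDD : D' ≤ D := by
    rw [hD, hD']
    exact_mod_cast Submodule.finrank_mono (pow_le_pow_V V h1V (Nat.mul_le_mul_left M (Nat.le_succ r)))
  have hloc := fun p => local_S V φ g hK hg h1V hφ hφV hφd r hinj p (ω p) (hV p)
  choose J hJ u hu huE huL using hloc
  let η : Point → ℤ := fun p => m * ∑ i, min 0 (v p (g i)) - ((M * (r + 1) : ℕ) + 1) * ω p
  have hη := fun p => range_lower V φ g (M * (r + 1)) hK hg hφV hφd p (ω p) (hV p)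
  have hext := fun p => extend_family hK p E (u p) (hu p) (huE p) _ (huL p) (η p) (hη p)
  choose u' α' hu' huE' huL' hsum using hext
  have hP := plucker hK P E S T0 (fun p => G p - (M * (r + 1) + 1) * ω p) (fun p => ∑ j, α' p j) (by
      intro p hp
      rw [hE]
      rintro _ ⟨c, rfl⟩
      rw [Theta_apply]
      apply Submodule.sum_mem
      intro b _
      refine Lv_mono hK (le_of_eq ?_) (Lv_mul hK (pow_le_Lv V hK p (ω p) (hV p) _ (c b).2) (hG p hp b))
      push_cast; ring) (by
      intro p _ hp
      rw [(h0 p hp).1, (h0 p hp).2]; simp) (fun p _ => ⟨u' p, α' p, hu' p, huE' p, huL' p, rfl⟩)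
  rw [hN] at hP
  have hβ : ∀ p, D' * (∑ l : expo n m, wt v g p l) - D' * ((expo n m).card - M) * (m * ∑ i, max 0 (v p (g i)))
      + (M * D - M * D') * (m * ∑ i, min 0 (v p (g i))) - M * D * (M * (r + 1) + 1) * ω p ≤ ∑ j, α' p j := by
    intro p
    rw [hsum p, hN]
    have h1 := wt_J (v := v) g p (J p) (hJ p)
    have h2 : ∑ i : Fin M × Fin (Module.finrank k ↥(V ^ (M * r))), (wt v g p (J p i.1) - M * (r + 1) * ω p)
        = D' * ∑ a, wt v g p (J p a) - M * D' * (M * (r + 1) * ω p) := by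
      rw [Fintype.sum_prod_type]
      simp only [Finset.sum_const, Finset.card_univ, Fintype.card_fin, nsmul_eq_mul, Finset.sum_sub_distrib, ← Finset.mul_sum]
      rw [← hD']; ring
    rw [h2]
    have h3 : (Fintype.card (Fin M × Fin (Module.finrank k ↥(V ^ (M * r)))) : ℤ) = M * D' := by
      simp [hD']
    rw [h3]
    have h4 := mul_le_mul_of_nonneg_left h1 hD0
    have h5 : 0 ≤ M * D' * ω p := by have := hω p; positivity
    simp only [η]
    push_cast
    nlinarith
  have hβ2 := Finset.sum_le_sum (fun p (_ : p ∈ S) => hβ p)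
  simp only [Finset.sum_sub_distrib, Finset.sum_add_distrib, ← Finset.mul_sum] at hβ2
  rw [sum_wt g hg S hgS hK] at hβ2
  have hmax : ∑ p ∈ S, ∑ i, max 0 (v p (g i)) ≤ n * H := by
    rw [Finset.sum_comm]
    refine (Finset.sum_le_sum fun i _ => hH i).trans ?_
    simp
  have hmin : -(n * H) ≤ ∑ p ∈ S, ∑ i, min 0 (v p (g i)) := by
    have e : ∑ p ∈ S, ∑ i, min 0 (v p (g i)) = - ∑ p ∈ S, ∑ i, max 0 (v p (g i)) := by
      have : ∑ p ∈ S, ∑ i, v p (g i) = 0 := by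
        rw [Finset.sum_comm]
        apply Finset.sum_eq_zero
        intro i _
        rw [sum_of_subset hK (g i) (hg i) S]
        intro p hp
        by_contra h
        exact hp (hgS p h i)
      rw [eq_neg_iff_add_eq_zero, ← Finset.sum_add_distrib]
      refine Eq.trans ?_ this
      refine Finset.sum_congr rfl fun p _ => ?_
      rw [← Finset.sum_add_distrib]
      refine Finset.sum_congr rfl fun i _ => ?_
      rw [min_add_max, zero_add]
    rw [e]; linarith
  have hω2 : ∑ p ∈ T0 \ S, ω p + ∑ p ∈ S, ω p = ∑ p ∈ T0, ω p := Finset.sum_sdiff hST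
  rw [Finset.sum_sub_distrib, ← Finset.mul_sum] at hP
  rw [← hω2]
  have hMe' : (0:ℤ) ≤ (expo n m).card - M := by
    have : (M : ℤ) ≤ (expo n m).card := by exact_mod_cast hMe
    linarith
  have t1 : D' * ((expo n m).card - M) * (m * ∑ p ∈ S, ∑ i, max 0 (v p (g i))) ≤ D' * ((expo n m).card - M) * (m * (n * H)) := by
    gcongr
  have t2 : (M * D - M * D') * (m * -(n * H)) ≤ (M * D - M * D') * (m * ∑ p ∈ S, ∑ i, min 0 (v p (g i))) := by
    have : (0:ℤ) ≤ M * D - M * D' := by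
      have : (0:ℤ) ≤ M * (D - D') := mul_nonneg (by positivity) (by linarith)
      linarith
    gcongr
  linarith
end Core
end Part10
end FunctionFieldGCD

namespace FunctionFieldGCD
section Part11

section Final
open MvPolynomial

lemma final_arith (M D D' X Mp m n H h χ r : ℝ) (hM : 0 ≤ M) (hD' : 0 < D') (hDD : D' ≤ D) (hX : 0 ≤ X)
    (hh : 0 ≤ h)
    (hc : 2 * ((M * D) * X) ≤ 2 * (D' * Mp * (m * (n * H)) + (M * D - M * D') * (m * (n * H))
        + M * D * (M * r + 1) * h) + (M * D) * (M * D - 1) * χ) (hMD : 0 ≤ (M * D) * (M * D - 1)) :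
    M * X ≤ (Mp + D / D' * M - M) * m * n * H + (D / D' * (1 + M * (r + 1))) * M * h
      + (D ^ 2 * M / (2 * D')) * M * max 0 χ := by
  have e : (Mp + D / D' * M - M) * m * n * H + (D / D' * (1 + M * (r + 1))) * M * h
      + (D ^ 2 * M / (2 * D')) * M * max 0 χ
      = (2 * (D' * Mp * (m * (n * H)) + (M * D - M * D') * (m * (n * H))
        + M * D * (M * (r + 1) + 1) * h) + (M * D) * (M * D) * max 0 χ) / (2 * D') := by
    field_simp
    ring
  rw [e, le_div_iff₀ (by positivity)]
  have hD : 0 ≤ D := by linarith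
  have h1 : M * X * D' ≤ M * X * D := by gcongr
  have h2 : (M * D) * (M * D - 1) * χ ≤ (M * D) * (M * D) * max 0 χ := by
    have a1 := mul_le_mul_of_nonneg_left (le_max_right 0 χ) hMD
    have a2 : 0 ≤ M * D * max 0 χ := by positivity
    linarith
  have h3 : 0 ≤ M * D * M * h := by positivity
  linarith

variable {k K Point : Type*} [Field k] [Field K] [Algebra k K] {v : Point → K → ℤ} {genus : ℕ}
  (hK : IsFunctionField k v genus) {n : ℕ}

lemma vPoly_le (p : Point) (F : MvPolynomial (Fin n) K) (l) (hl : l ∈ F.support) : vPoly v p F ≤ v p (coeff l F) := by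
  unfold vPoly
  rw [dif_pos ⟨l, hl⟩]
  exact Finset.inf'_le _ hl

lemma vPoly_nonpos (hK : IsFunctionField k v genus) (p : Point) (F : MvPolynomial (Fin n) K)
    (hc : ∃ mm ∈ F.support, coeff mm F = 1) : vPoly v p F ≤ 0 := by
  obtain ⟨l, hl, h⟩ := hc
  have := vPoly_le (v := v) p F l hl
  rwa [h, hK.v_one] at this

lemma vPoly_finite (hK : IsFunctionField k v genus) (F : MvPolynomial (Fin n) K) : {p : Point | vPoly v p F ≠ 0}.Finite := by
  have : (⋃ l ∈ F.support, {p : Point | v p (coeff l F) ≠ 0}).Finite := by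
    apply Set.Finite.biUnion (Finset.finite_toSet _)
    intro l hl
    exact hK.finite_support _ (mem_support_iff.1 hl)
  refine this.subset ?_
  intro p hp
  unfold vPoly at hp
  simp only [Set.mem_setOf_eq] at hp
  by_cases h : F.support.Nonempty
  · rw [dif_pos h] at hp
    obtain ⟨l, hl, e⟩ := Finset.exists_mem_eq_inf' h (fun mm => v p (coeff mm F))
    rw [e] at hp
    simp only [Set.mem_iUnion]
    exact ⟨l, hl, hp⟩
  · rw [dif_neg h] at hp
    exact absurd rfl hp

lemma hPoly_eq (F : MvPolynomial (Fin n) K) (T : Finset Point) (hT : ∀ p, vPoly v p F ≠ 0 → p ∈ T) :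
    hPoly v F = ∑ p ∈ T, -(vPoly v p F) := by
  apply finsum_eq_sum_of_support_subset
  intro p hp
  exact hT p (by simpa using hp)

lemma coeff_Lv (p : Point) (F : MvPolynomial (Fin n) K) (l) : coeff l F ∈ Lv hK p (vPoly v p F) := by
  by_cases h : coeff l F = 0
  · rw [h]; exact zero_mem _
  · exact Or.inr (vPoly_le p F l (mem_support_iff.2 h))

lemma eval_Lv (p : Point) (F : MvPolynomial (Fin n) K) (g : Fin n → K) (hg : ∀ i, g i ∈ Lv hK p 0) :
    eval g F ∈ Lv hK p (vPoly v p F) := by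
  rw [eval_eq']
  apply Submodule.sum_mem
  intro l _
  have := Lv_prod hK (p := p) Finset.univ (fun i => g i ^ l i) (fun _ => 0)
    (fun i _ => by simpa using Lv_pow hK (hg i) (l i))
  simpa using Lv_mul hK (coeff_Lv hK p F l) this

lemma height_eq (hK : IsFunctionField k v genus) (f : K) (hf : f ≠ 0) (S : Finset Point) (hS : ∀ p, p ∉ S → v p f = 0) :
    ∑ p ∈ S, max 0 (v p f) = height v f := by
  have e : height v f = ∑ p ∈ S, max 0 (-(v p f)) := by
    apply finsum_eq_sum_of_support_subset
    intro p hp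
    by_contra h
    apply hp
    simp [hS p h]
  rw [e, ← sub_eq_zero, ← Finset.sum_sub_distrib]
  refine Eq.trans ?_ (sum_of_subset hK f hf S (fun p hp => by by_contra h; exact hp (hS p h)))
  refine Finset.sum_congr rfl fun p _ => ?_
  omega

lemma height_le (hK : IsFunctionField k v genus) (g : Fin n → K) (i : Fin n) : height v (g i) ≤ maxHeight v g := by
  have h := Finset.le_sup (f := fun i => (height v (g i)).toNat) (Finset.mem_univ i)
  have h2 := Int.self_le_toNat (height v (g i))
  unfold maxHeight
  refine h2.trans ?_
  exact_mod_cast h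

lemma part3 [CharZero k] (hK : IsFunctionField k v genus) (d : ℕ) (hd : 0 < d)
    (F1 F2 : MvPolynomial (Fin n) K) (hcop : CoprimePoly F1 F2)
    (hd1 : F1.totalDegree = d) (hd2 : F2.totalDegree = d)
    (hc1 : ∃ mm ∈ F1.support, coeff mm F1 = 1)
    (hc2 : ∃ mm ∈ F2.support, coeff mm F2 = 1) (S : Finset Point) (m r : ℕ) (hm : 2 * d ≤ m)
    (g : Fin n → K) (hg : ∀ i, g i ≠ 0) (hgS : ∀ p, p ∉ S → ∀ i, v p (g i) = 0)
    (hnd : ∀ P : MvPolynomial (Fin n) K,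
          (∀ mm, coeff mm P ∈ (coeffSpan2 k F1 F2) ^ (Mconst n d m * (r + 1) + 1)) →
          P.totalDegree ≤ m → eval g P = 0 → P = 0) 
    (M D D' : ℕ) (hM : M = Mconst n d m) 
    (hD : D = Module.finrank k ↥((coeffSpan2 k F1 F2) ^ (Mconst n d m * (r + 1))))
    (hD' : D' = Module.finrank k ↥((coeffSpan2 k F1 F2) ^ (Mconst n d m * r))) :
    0 < D' ∧ D' ≤ D ∧ 0 ≤ NSgcd v (S : Set Point) (eval g F1) (eval g F2) ∧
    0 ≤ hPoly v F1 + hPoly v F2 ∧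
    2 * ((M * D : ℤ) * NSgcd v (S : Set Point) (eval g F1) (eval g F2)) ≤
      2 * (D' * Mprime n d m * (m * (n * maxHeight v g)) + (M * D - M * D') * (m * (n * maxHeight v g))
        + M * D * (M * (r + 1) + 1) * (hPoly v F1 + hPoly v F2))
      + (M * D) * (M * D - 1) * (2 * genus - 2 + S.card) := by
  set V := coeffSpan2 k F1 F2 with hVdef
  have hF1 : F1 ≠ 0 := by rintro rfl; simp at hd1; omega
  have hF2 : F2 ≠ 0 := by rintro rfl; simp at hd2; omega
  have hcV1 : ∀ l, coeff l F1 ∈ V := by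
    intro l
    by_cases h : coeff l F1 = 0
    · rw [h]; exact zero_mem _
    · exact Submodule.subset_span (Or.inl ⟨l, mem_support_iff.2 h, rfl⟩)
  have hcV2 : ∀ l, coeff l F2 ∈ V := by
    intro l
    by_cases h : coeff l F2 = 0
    · rw [h]; exact zero_mem _
    · exact Submodule.subset_span (Or.inr ⟨l, mem_support_iff.2 h, rfl⟩)
  have h1V : (1 : K) ∈ V := by
    obtain ⟨l, _, h⟩ := hc1
    rw [← h]; exact hcV1 l
  haveI : Module.Finite k V := by
    apply Module.Finite.iff_fg.2
    apply Submodule.fg_span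
    exact ((Finset.finite_toSet _).image _).union ((Finset.finite_toSet _).image _)
  haveI hfin : ∀ a : ℕ, Module.Finite k ↥(V ^ a) := fun a =>
    Module.Finite.iff_fg.2 ((Module.Finite.iff_fg.1 inferInstance).pow a)
  have hVq : V ≤ V ^ (Mconst n d m * (r + 1) + 1) := by
    have := pow_le_pow_V V h1V (show 1 ≤ Mconst n d m * (r + 1) + 1 by omega)
    rwa [pow_one] at this
  have h1q : ∀ a : ℕ, (1 : K) ∈ V ^ a := fun a => by
    have := pow_le_pow_V V h1V (Nat.zero_le a)
    exact this (by simp)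
  have hD'0 : 0 < D' := by
    rw [hD']
    haveI : Nontrivial ↥(V ^ (Mconst n d m * r)) := ⟨⟨0, ⟨1, h1q _⟩, fun h => by
      have := congrArg Subtype.val h
      simp at this⟩⟩
    exact Module.finrank_pos
  have hDD : D' ≤ D := by
    rw [hD, hD']
    exact Submodule.finrank_mono (pow_le_pow_V V h1V (Nat.mul_le_mul_left _ (Nat.le_succ r)))
  have hE1 : eval g F1 ≠ 0 := fun h => hF1 (hnd F1 (fun l => hVq (hcV1 l)) (by omega) h)
  have hE2 : eval g F2 ≠ 0 := fun h => hF2 (hnd F2 (fun l => hVq (hcV2 l)) (by omega) h)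
  -- a point
  have hn : 0 < n := by
    rcases Nat.eq_zero_or_pos n with h | h
    · subst h
      rw [eq_C_of_isEmpty F1, totalDegree_C] at hd1
      omega
    · exact h
  have hP : Nonempty Point := by
    by_contra hne
    rw [not_nonempty_iff] at hne
    obtain ⟨c, hc⟩ := hK.const_of_nonneg (g ⟨0, hn⟩) (hg _) (fun p => hne.elim p)
    have hQ := hnd (X ⟨0, hn⟩ - C (algebraMap k K c)) (by
      intro l
      rw [coeff_sub]
      apply Submodule.sub_mem
      · rw [coeff_X']
        split_ifs
        · exact h1q _
        · exact zero_mem _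
      · rw [coeff_C]
        split_ifs
        · rw [Algebra.algebraMap_eq_smul_one]
          exact Submodule.smul_mem _ _ (h1q _)
        · exact zero_mem _) (by
      refine (totalDegree_sub _ _).trans ?_
      rw [totalDegree_X, totalDegree_C]
      simp; omega) (by simp [hc])
    have := congrArg (coeff (Finsupp.single ⟨0, hn⟩ 1)) hQ
    have hne0 : (0 : Fin n →₀ ℕ) ≠ Finsupp.single ⟨0, hn⟩ 1 := by
      intro h
      have := congrArg (fun f => f ⟨0, hn⟩) h
      simp at this
    rw [coeff_sub, coeff_X, coeff_C, if_pos rfl, if_neg hne0, coeff_zero, sub_zero] at this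
    exact one_ne_zero this
  obtain ⟨P⟩ := hP
  obtain ⟨φ, hφ, hφ'⟩ := poly_family d m hm F1 F2 hcop hF1 hF2 hd1 hd2
  have hcm : ∀ (F : MvPolynomial (Fin n) K), (∀ l, coeff l F ∈ V) → ∀ i l, coeff l (F * monomial i 1) ∈ V := by
    intro F hF i l
    rw [coeff_mul_monomial']
    split_ifs
    · simpa using hF _
    · exact zero_mem _
  have hφV : ∀ b l, coeff l (φ b) ∈ V := by
    intro b l
    obtain ⟨i, _, h | h⟩ := hφ' b
    · rw [h]; exact hcm _ hcV1 i l
    · rw [h]; exact hcm _ hcV2 i l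
  have hmd : ∀ i : Fin n →₀ ℕ, ∑ j, i j ≤ m - d → (monomial i (1:K)).totalDegree ≤ m - d := by
    intro i hi
    rw [totalDegree_monomial _ one_ne_zero, Finsupp.sum_fintype _ _ (fun _ => rfl)]
    exact hi
  have hφd : ∀ b, (φ b).totalDegree ≤ m := by
    intro b
    obtain ⟨i, hi, h | h⟩ := hφ' b
    · rw [h]
      have := totalDegree_mul F1 (monomial i (1:K))
      have := hmd i hi
      omega
    · rw [h]
      have := totalDegree_mul F2 (monomial i (1:K))
      have := hmd i hi
      omega
  have hinj := Theta_inj V φ g (Mconst n d m * (r + 1)) hφ hφV hφd hnd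
  let ω : Point → ℤ := fun p => -(vPoly v p F1) + -(vPoly v p F2)
  let G : Point → ℤ := fun p => minv0 v p (eval g F1) (eval g F2)
  have hGeq : ∀ p, G p = min (max 0 (v p (eval g F1))) (max 0 (v p (eval g F2))) := by
    intro p
    simp only [G, minv0, if_neg hE1, if_neg hE2, v0]
  have hv1 := fun p => vPoly_nonpos hK p F1 hc1
  have hv2 := fun p => vPoly_nonpos hK p F2 hc2
  let T0 : Finset Point := S ∪ (vPoly_finite hK F1).toFinset ∪ (vPoly_finite hK F2).toFinset
    ∪ (hK.finite_support _ hE1).toFinset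
  have hT0 : ∀ p, p ∉ T0 → p ∉ S ∧ vPoly v p F1 = 0 ∧ vPoly v p F2 = 0 ∧ v p (eval g F1) = 0 := by
    intro p hp
    simp only [T0, Finset.mem_union, Set.Finite.mem_toFinset, Set.mem_setOf_eq, not_or, not_not] at hp
    tauto
  have hG0 : ∀ p, p ∉ T0 → G p = 0 := by
    intro p hp
    rw [hGeq, (hT0 p hp).2.2.2]
    omega
  have hST : S ⊆ T0 := by
    intro p hp
    by_contra h
    exact (hT0 p h).1 hp
  have hX : NSgcd v (S : Set Point) (eval g F1) (eval g F2) = ∑ p ∈ T0 \ S, G p := by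
    unfold NSgcd
    apply finsum_mem_eq_sum_of_inter_support_eq
    ext p
    simp only [Set.mem_inter_iff, Set.mem_compl_iff, Finset.mem_coe, Finset.mem_sdiff, Function.mem_support]
    constructor
    · rintro ⟨h1, h2⟩
      exact ⟨⟨by by_contra h; exact h2 (hG0 p h), h1⟩, h2⟩
    · rintro ⟨⟨_, h1⟩, h2⟩
      exact ⟨h1, h2⟩
  have hω : ∀ p, 0 ≤ ω p := fun p => by have := hv1 p; have := hv2 p; simp only [ω]; omega
  have hh : hPoly v F1 + hPoly v F2 = ∑ p ∈ T0, ω p := by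
    rw [hPoly_eq F1 T0 (fun p hp => by by_contra h; exact hp (hT0 p h).2.1),
      hPoly_eq F2 T0 (fun p hp => by by_contra h; exact hp (hT0 p h).2.2.1), ← Finset.sum_add_distrib]
  have hVL : ∀ p, V ≤ Lv hK p (-ω p) := by
    intro p
    rw [hVdef, coeffSpan2, Submodule.span_le]
    have := hv1 p
    have := hv2 p
    rintro _ (⟨l, _, rfl⟩ | ⟨l, _, rfl⟩)
    · exact Lv_mono hK (by simp only [ω]; omega) (coeff_Lv hK p F1 l)
    · exact Lv_mono hK (by simp only [ω]; omega) (coeff_Lv hK p F2 l)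
  have hgL : ∀ p, p ∉ S → ∀ i, g i ∈ Lv hK p 0 := fun p hp i => Or.inr (by rw [hgS p hp i])
  have hmonL : ∀ p, p ∉ S → ∀ i : Fin n →₀ ℕ, eval g (monomial i (1:K)) ∈ Lv hK p 0 := by
    intro p hp i
    have := gl_Lv g hK hg p i
    rw [eval_monomial, one_mul, Finsupp.prod_fintype _ _ (fun _ => pow_zero _)]
    convert this using 2
    unfold wt
    simp [hgS p hp]
  have hGL : ∀ p, p ∉ S → ∀ b, eval g (φ b) ∈ Lv hK p (G p - ω p) := by
    intro p hp b
    have e1 := eval_Lv hK p F1 g (hgL p hp)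
    have e2 := eval_Lv hK p F2 g (hgL p hp)
    rw [mem_Lv' hK hE1] at e1
    rw [mem_Lv' hK hE2] at e2
    have := hv1 p
    have := hv2 p
    have := hGeq p
    obtain ⟨i, hi, h | h⟩ := hφ' b
    · rw [h, map_mul]
      refine Lv_mono hK ?_ (Lv_mul hK (Lv_self hK (eval g F1)) (hmonL p hp i))
      simp only [ω]
      omega
    · rw [h, map_mul]
      refine Lv_mono hK ?_ (Lv_mul hK (Lv_self hK (eval g F2)) (hmonL p hp i))
      simp only [ω]
      omega
  have hMe := Mconst_le d m hm F1 F2 hcop hF1 hF2 hd1 hd2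
  have hmain := core hK P V h1V φ g r hφ hφV hφd hinj hg S T0 hST hgS ω G hω hVL hGL
    (fun p hp => ⟨hG0 p hp, by simp only [ω]; rw [(hT0 p hp).2.1, (hT0 p hp).2.2.1]; rfl⟩)
    (maxHeight v g) (fun i => by
      rw [height_eq hK (g i) (hg i) S (fun p hp => hgS p hp i)]
      exact height_le hK g i) (by rw [card_expo]; exact hMe) D D' (by rw [hD]) (by rw [hD'])
  refine ⟨hD'0, hDD, ?_, ?_, ?_⟩
  · rw [hX]
    apply Finset.sum_nonneg
    intro p _
    rw [hGeq]; omega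
  · rw [hh]
    exact Finset.sum_nonneg fun p _ => hω p
  · rw [hX, hh, hM]
    have e : ((Mprime n d m : ℕ) : ℤ) = ((expo n m).card : ℤ) - Mconst n d m := by
      rw [card_expo, Mprime, Nat.cast_sub hMe]
    rw [e]
    exact hmain
end Final
end Part11
end FunctionFieldGCD

namespace FunctionFieldGCD

variable {K : Type*} [Field K] {Point : Type*}

/-- **Theorem 6.3.**  For coprime `F₁, F₂` of the same degree `d > 0`, each with a
coefficient equal to `1`: (1) `M'_m = C(m+n,n) − 2C(m+n−d,n) + C(m+n−2d,n) = O(m^{n−2})`;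
(2) if the monomials `g^i`, `|i| ≤ m`, are linearly nondegenerate over `V_{F₁,F₂}(Mr+1)`
(equivalently: no nonzero polynomial of degree `≤ m` with coefficients in `V_{F₁,F₂}(Mr+1)`
vanishes at `g`), then `M·N_{S,gcd}(F₁(g),F₂(g))` is bounded as stated. -/
theorem gcd_refinement
    (k K Point : Type*) [Field k] [Field K] [Algebra k K] [IsAlgClosed k] [CharZero k]
    (v : Point → K → ℤ) (genus : ℕ) (hK : IsFunctionField k v genus)
    (n d : ℕ) (hd : 0 < d)
    (F1 F2 : MvPolynomial (Fin n) K) (hcop : CoprimePoly F1 F2)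
    (hd1 : F1.totalDegree = d) (hd2 : F2.totalDegree = d)
    (hc1 : ∃ mm ∈ F1.support, MvPolynomial.coeff mm F1 = 1)
    (hc2 : ∃ mm ∈ F2.support, MvPolynomial.coeff mm F2 = 1) :
    (∀ m : ℕ, 2 * d ≤ m →
      (Mprime n d m : ℤ) = (Nat.choose (m + n) n : ℤ)
        - 2 * (Nat.choose (m + n - d) n : ℤ) + (Nat.choose (m + n - 2 * d) n : ℤ))
    ∧ (∃ C : ℝ, ∀ m : ℕ, 2 * d ≤ m → (Mprime n d m : ℝ) ≤ C * (m : ℝ) ^ (n - 2))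
    ∧ (∀ (S : Set Point), S.Finite →
      ∀ (m r : ℕ), 2 * d ≤ m → 0 < r →
      ∀ g : Fin n → K, (∀ i, IsSUnit v S (g i)) →
      (∀ P : MvPolynomial (Fin n) K,
          (∀ mm, MvPolynomial.coeff mm P ∈ (coeffSpan2 k F1 F2) ^ (Mconst n d m * r + 1)) →
          P.totalDegree ≤ m → MvPolynomial.eval g P = 0 → P = 0) →
      (Mconst n d m : ℝ) * (NSgcd v S (MvPolynomial.eval g F1) (MvPolynomial.eval g F2) : ℝ)
        ≤ ((Mprime n d m : ℝ)
              + ((Module.finrank k ↥((coeffSpan2 k F1 F2) ^ (Mconst n d m * r)) : ℝ)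
                    / (Module.finrank k ↥((coeffSpan2 k F1 F2) ^ (Mconst n d m * (r - 1))) : ℝ))
                  * (Mconst n d m : ℝ)
              - (Mconst n d m : ℝ)) * (m : ℝ) * (n : ℝ) * (maxHeight v g : ℝ)
          + (((Module.finrank k ↥((coeffSpan2 k F1 F2) ^ (Mconst n d m * r)) : ℝ)
                  / (Module.finrank k ↥((coeffSpan2 k F1 F2) ^ (Mconst n d m * (r - 1))) : ℝ))
                * (1 + (Mconst n d m : ℝ) * ((r : ℝ) + 1)))
              * (Mconst n d m : ℝ) * ((hPoly v F1 : ℝ) + (hPoly v F2 : ℝ))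
          + ((Module.finrank k ↥((coeffSpan2 k F1 F2) ^ (Mconst n d m * r)) : ℝ) ^ 2
                * (Mconst n d m : ℝ)
                / (2 * (Module.finrank k ↥((coeffSpan2 k F1 F2) ^ (Mconst n d m * (r - 1))) : ℝ)))
              * (Mconst n d m : ℝ) * max 0 (2 * (genus : ℝ) - 2 + (S.ncard : ℝ))) := by
  have hF1 : F1 ≠ 0 := by rintro rfl; simp at hd1; omega
  have hF2 : F2 ≠ 0 := by rintro rfl; simp at hd2; omega
  have hMe : ∀ m, 2 * d ≤ m → Mconst n d m ≤ (m + n).choose n := fun m hm =>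
    Mconst_le d m hm F1 F2 hcop hF1 hF2 hd1 hd2
  refine ⟨fun m hm => Mprime_formula d m hm (hMe m hm), Mprime_bound d hd hMe, ?_⟩
  intro S hS m r hm hr g hg hnd
  obtain ⟨r, rfl⟩ : ∃ r', r = r' + 1 := ⟨r - 1, by omega⟩
  obtain ⟨a1, a2, a3, a4, a5⟩ := part3 hK d hd F1 F2 hcop hd1 hd2 hc1 hc2 hS.toFinset m r hm g
    (fun i => (hg i).1) (fun p hp i => (hg i).2 p (by simpa using hp)) hnd _ _ _ rfl rfl rfl
  rw [Set.Finite.coe_toFinset] at a3 a5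
  rw [Nat.add_sub_cancel, Set.ncard_eq_toFinset_card S hS]
  refine final_arith _ _ _ _ _ _ _ _ _ _ _ (by positivity) (by exact_mod_cast a1) (by exact_mod_cast a2)
    (by exact_mod_cast a3) (by exact_mod_cast a4) ?_ ?_
  · push_cast
    exact_mod_cast a5
  · have hx : ∀ x : ℕ, (0 : ℝ) ≤ (x : ℝ) * ((x : ℝ) - 1) := by
      intro x
      rcases x with _ | x
      · simp
      · push_cast
        have : (0 : ℝ) ≤ x := Nat.cast_nonneg x
        nlinarith
    have := hx (Mconst n d m * Module.finrank k ↥(coeffSpan2 k F1 F2 ^ (Mconst n d m * (r + 1))))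
    push_cast at this
    exact this

end FunctionFieldGCD
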